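/- arXiv:1310.6603 — 6 statements merged into one kernel-verified Lean document; each statement's English description precedes it below -/
import Mathlib

section
/- Information-theoretic noise–disturbance tradeoff (Theorem 1). Let d ≥ 1 and let {ψ^x}_{x ∈ Fin d} and {φ^z}_{z ∈ Fin d} be two orthonormal bases of ℂ^d (the eigenbases of two nondegenerate observables X and Z). Let a quantum instrument be given by Kraus operators K(m,j) and a correction operation by Kraus operators E(m,l). Define the joint distributions p_N(m,x) := (1/d) ∑_{j∈J} ‖K(m,j) ψ^x‖² on M × Fin d, and p_D(ẑ,z) := (1/d) ∑_{m∈M} ∑_{j∈J} ∑_{l∈L} |⟨φ^{ẑ}, E(m,l) K(m,j) φ^z⟩|² on Fin d × Fin d. Then H(X|M) + H(Z|Ẑ) ≥ −log₂ c, where H(X|M) is the conditional entropy of x given m computed from p_N, H(Z|Ẑ) is the conditional entropy of z given ẑ computed from p_D, and c := max_{x,z} |⟨ψ^x, φ^z⟩|². -/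
open scoped BigOperators Matrix

/-- Shannon entropy (base 2) of a distribution on a finite type. -/
noncomputable def entropy2 {α : Type*} [Fintype α] (p : α → ℝ) : ℝ :=
  ∑ a, -(p a * Real.logb 2 (p a))

/-- Conditional entropy `H(A|B)` (base 2) of a joint distribution `p : B × A → ℝ`,
conditioning on the first coordinate. -/
noncomputable def condEntropy2 {β α : Type*} [Fintype β] [Fintype α]
    (p : β × α → ℝ) : ℝ :=
  entropy2 p - entropy2 (fun b => ∑ a, p (b, a))

/-- Hermitian inner product on `Fin n → ℂ`, antilinear in the first argument. -/
noncomputable def dotc {n : ℕ} (u v : Fin n → ℂ) : ℂ :=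
  ∑ i, (starRingEnd ℂ) (u i) * v i

theorem ofReal_sum_normSq {k : Type*} [Fintype k] (w : k → ℂ) :
    ((∑ i, Complex.normSq (w i) : ℝ) : ℂ) = star w ⬝ᵥ w := by
  simp [dotProduct, Complex.normSq_eq_conj_mul_self]

theorem sum_normSq_mulVec {ι m n : Type*} [Fintype ι] [Fintype m] [Fintype n] [DecidableEq n]
    (A : ι → Matrix m n ℂ) (hA : ∑ l, (A l)ᴴ * A l = 1) (u : n → ℂ) :
    ∑ l, ∑ i, Complex.normSq ((A l).mulVec u i) = ∑ i, Complex.normSq (u i) := by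
  apply Complex.ofReal_injective
  rw [ofReal_sum_normSq, Complex.ofReal_sum]
  simp_rw [ofReal_sum_normSq, Matrix.star_mulVec, ← Matrix.dotProduct_mulVec, Matrix.mulVec_mulVec]
  rw [← dotProduct_sum, ← Matrix.sum_mulVec, hA, Matrix.one_mulVec]

theorem sum_normSq_mulVec_of_isometry {m n : Type*} [Fintype m] [Fintype n] [DecidableEq n]
    (U : Matrix m n ℂ) (hU : Uᴴ * U = 1) (u : n → ℂ) :
    ∑ i, Complex.normSq (U.mulVec u i) = ∑ i, Complex.normSq (u i) := by
  simpa using sum_normSq_mulVec (fun _ : Unit => U) (by simpa using hU) u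

/-- The inequality `f'(0) ≤ N L` for functions with `f(0) = N` that stay below `N exp (θ L)`. -/
theorem deriv_le_of_le_exp {f : ℝ → ℝ} {f' N L : ℝ} (hf : HasDerivAt f f' 0) (h0 : f 0 = N)
    (hle : ∀ θ ∈ Set.Icc (0 : ℝ) 1, f θ ≤ N * Real.exp (θ * L)) : f' ≤ N * L := by
  have hg : HasDerivAt (fun θ : ℝ => N * Real.exp (θ * L) - f θ) (N * L - f') 0 := by
    have := (((hasDerivAt_id (0 : ℝ)).mul_const L).exp.const_mul N).sub hf
    simpa [Pi.sub_def] using this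
  refine sub_nonneg.1 (ge_of_tendsto hg.tendsto_slope_zero_right ?_)
  filter_upwards [Ioo_mem_nhdsGT (zero_lt_one' ℝ)] with t ht
  have := hle t ⟨ht.1.le, ht.2.le⟩
  have : 0 ≤ N * Real.exp (t * L) - f t := sub_nonneg.2 this
  simp only [zero_add, smul_eq_mul, zero_mul, Real.exp_zero, h0]
  have := inv_pos.2 ht.1
  rw [mul_one, sub_self, sub_zero]
  positivity

/-- The Maassen–Uffink entropic uncertainty relation for an unnormalized vector `a`. -/
theorem maassen_uffink {m n : Type*} [Fintype m] [Fintype n] [DecidableEq n]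
    (U : Matrix m n ℂ) (hU : Uᴴ * U = 1) {c : ℝ} (hc : 0 < c)
    (hUc : ∀ z x, Complex.normSq (U z x) ≤ c) (a : n → ℂ) :
    -(∑ x, Complex.normSq (a x)) * Real.log c ≤
      ∑ x, Real.negMulLog (Complex.normSq (a x))
        + ∑ z, Real.negMulLog (Complex.normSq (U.mulVec a z))
        - 2 * Real.negMulLog (∑ x, Complex.normSq (a x)) := by
  set N := ∑ x, Complex.normSq (a x) with hN
  set b := U.mulVec a with hb
  have hbN : ∑ z, Complex.normSq (b z) = N := sum_normSq_mulVec_of_isometry U hU a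
  have hN0 : 0 ≤ N := Finset.sum_nonneg fun _ _ => Complex.normSq_nonneg _
  rcases hN0.eq_or_lt with h0 | hNpos
  · have ha : ∀ x, Complex.normSq (a x) = 0 := fun x =>
      (Finset.sum_eq_zero_iff_of_nonneg fun _ _ => Complex.normSq_nonneg _).1 h0.symm x
        (Finset.mem_univ x)
    have hb : ∀ z, Complex.normSq (b z) = 0 := fun z =>
      (Finset.sum_eq_zero_iff_of_nonneg fun _ _ => Complex.normSq_nonneg _).1
        (hbN.trans h0.symm) z (Finset.mem_univ z)
    simp [ha, hb, ← h0]
  let ra := fun x => Real.log ‖a x‖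
  let rb := fun z => Real.log ‖b z‖
  let F : ℂ → ℂ := fun s => ∑ z, (starRingEnd ℂ) (b z) * Complex.exp (s * rb z) *
    U.mulVec (fun x => a x * Complex.exp (s * ra x)) z
  have hexp (s : ℂ) (r : ℝ) : ‖Complex.exp (s * r)‖ = Real.exp (s.re * r) := by
    simp [Complex.norm_exp]
  have hUn (z x) : ‖U z x‖ ≤ √c := by
    rw [← Real.sqrt_sq (norm_nonneg (U z x)), ← Complex.normSq_eq_norm_sq]
    exact Real.sqrt_le_sqrt (hUc z x)
  have hF_left : ∀ s ∈ Complex.re ⁻¹' {0}, ‖F s‖ ≤ N := by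
    intro s hs
    have hs : s.re = 0 := hs
    calc ‖F s‖ ≤ ∑ z, (Complex.normSq (b z) + Complex.normSq
            (U.mulVec (fun x => a x * Complex.exp (s * ra x)) z)) / 2 := by
          refine norm_sum_le_of_le _ fun z _ => ?_
          rw [norm_mul, norm_mul, hexp, hs, zero_mul, Real.exp_zero, mul_one, RCLike.norm_conj,
            Complex.normSq_eq_norm_sq, Complex.normSq_eq_norm_sq]
          linarith [two_mul_le_add_sq ‖b z‖ ‖U.mulVec (fun x => a x * Complex.exp (s * ra x)) z‖]
      _ = N := by
          rw [← Finset.sum_div, Finset.sum_add_distrib, hbN, sum_normSq_mulVec_of_isometry U hU]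
          simp [Complex.normSq_eq_norm_sq, hexp, hs, hN]
  have hlog (w : ℂ) : ‖w‖ * Real.exp (Real.log ‖w‖) = Complex.normSq w := by
    rcases eq_or_ne w 0 with rfl | hw
    · simp
    · rw [Real.exp_log (norm_pos_iff.2 hw), Complex.normSq_eq_norm_sq, sq]
  have hF_right : ∀ s ∈ Complex.re ⁻¹' {1}, ‖F s‖ ≤ √c * N ^ 2 := by
    intro s hs
    have hs : s.re = 1 := hs
    calc ‖F s‖ ≤ ∑ z, Complex.normSq (b z) * (√c * N) := by
          refine norm_sum_le_of_le _ fun z _ => ?_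
          rw [norm_mul, norm_mul, hexp, hs, one_mul, RCLike.norm_conj, hlog]
          refine mul_le_mul_of_nonneg_left ?_ (Complex.normSq_nonneg _)
          rw [hN, Finset.mul_sum]
          refine norm_sum_le_of_le _ fun x _ => ?_
          rw [norm_mul, norm_mul, hexp, hs, one_mul, hlog]
          exact mul_le_mul_of_nonneg_right (hUn z x) (Complex.normSq_nonneg _)
      _ = √c * N ^ 2 := by rw [← Finset.sum_mul, hbN]; ring
  have hF_diff : Differentiable ℂ F := by
    simp only [F, Matrix.mulVec, dotProduct]
    fun_prop
  have hF_bdd : BddAbove ((norm ∘ F) '' Complex.HadamardThreeLines.verticalClosedStrip 0 1) := by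
    refine ⟨∑ z, ‖b z‖ * Real.exp |rb z| * ∑ x, ‖U z x‖ * (‖a x‖ * Real.exp |ra x|), ?_⟩
    rintro _ ⟨s, hs, rfl⟩
    have hs : s.re ∈ Set.Icc (0 : ℝ) 1 := hs
    have hle (r : ℝ) : Real.exp (s.re * r) ≤ Real.exp |r| := by
      refine Real.exp_le_exp.2 ((le_abs_self _).trans ?_)
      rw [abs_mul, abs_of_nonneg hs.1]
      exact mul_le_of_le_one_left (abs_nonneg _) hs.2
    refine norm_sum_le_of_le _ fun z _ => ?_
    rw [norm_mul, norm_mul, hexp, RCLike.norm_conj]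
    refine mul_le_mul (mul_le_mul_of_nonneg_left (hle _) (norm_nonneg _)) ?_ (norm_nonneg _)
      (by positivity)
    refine norm_sum_le_of_le _ fun x _ => ?_
    rw [norm_mul, norm_mul, hexp]
    exact mul_le_mul_of_nonneg_left (mul_le_mul_of_nonneg_left (hle _) (norm_nonneg _))
      (norm_nonneg _)
  let g : ℝ → ℝ := fun θ => ∑ z, ∑ x, ((starRingEnd ℂ) (b z) * (U z x * a x)).re *
    Real.exp (θ * (rb z + ra x))
  have hgF (θ : ℝ) : g θ = (F θ).re := by
    simp only [g, F, Complex.re_sum, Matrix.mulVec, dotProduct, Finset.mul_sum]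
    refine Finset.sum_congr rfl fun z _ => Finset.sum_congr rfl fun x _ => ?_
    rw [← Complex.re_mul_ofReal]
    congr 1
    push_cast
    rw [mul_add, Complex.exp_add]
    ring
  have hrow (z) : ∑ x, ((starRingEnd ℂ) (b z) * (U z x * a x)).re = Complex.normSq (b z) := by
    rw [← Complex.re_sum, ← Finset.mul_sum]
    change ((starRingEnd ℂ) (b z) * b z).re = _
    rw [← Complex.normSq_eq_conj_mul_self, Complex.ofReal_re]
  have hcol (x) : ∑ z, ((starRingEnd ℂ) (b z) * (U z x * a x)).re = Complex.normSq (a x) := by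
    have h1 : Uᴴ.mulVec b = a := by rw [hb, Matrix.mulVec_mulVec, hU, Matrix.one_mulVec]
    have h2 : ∑ z, (starRingEnd ℂ) (b z) * U z x = (starRingEnd ℂ) (a x) := by
      conv_rhs => rw [← h1]
      simp [Matrix.mulVec, dotProduct, mul_comm]
    rw [← Complex.re_sum]
    simp_rw [← mul_assoc]
    rw [← Finset.sum_mul, h2, ← Complex.normSq_eq_conj_mul_self, Complex.ofReal_re]
  have hg0 : g 0 = N := by simp only [g, zero_mul, Real.exp_zero, mul_one, hrow, hbN]
  have hg : HasDerivAt g (∑ z, ∑ x, ((starRingEnd ℂ) (b z) * (U z x * a x)).re *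
      (rb z + ra x)) 0 := by
    refine HasDerivAt.fun_sum fun z _ => HasDerivAt.fun_sum fun x _ => ?_
    have := (((hasDerivAt_id (0 : ℝ)).mul_const (rb z + ra x)).exp.const_mul
      ((starRingEnd ℂ) (b z) * (U z x * a x)).re)
    simpa using this
  have hder := deriv_le_of_le_exp (L := Real.log (√c * N)) hg hg0 fun θ hθ => by
    have h := Complex.HadamardThreeLines.norm_le_interp_of_mem_verticalClosedStrip₀₁' F
      (z := θ) (by simpa [Complex.HadamardThreeLines.verticalClosedStrip] using hθ)
      hF_diff.diffContOnCl hF_bdd hF_left hF_right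
    rw [hgF]
    refine (Complex.re_le_norm _).trans (h.trans_eq ?_)
    have hcN : 0 < √c * N := by positivity
    rw [Complex.ofReal_re, show √c * N ^ 2 = N * (√c * N) by ring,
      Real.mul_rpow hNpos.le hcN.le, ← mul_assoc, ← Real.rpow_add hNpos, sub_add_cancel,
      Real.rpow_one, Real.rpow_def_of_pos hcN, mul_comm θ]
  simp_rw [mul_add, Finset.sum_add_distrib] at hder
  rw [Finset.sum_comm (f := fun z x => _ * ra x)] at hder
  simp_rw [← Finset.sum_mul, hrow, hcol] at hder
  rw [Real.log_mul (by positivity) hNpos.ne', Real.log_sqrt hc.le] at hder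
  have hent (w : ℂ) : Real.negMulLog (Complex.normSq w)
      = -2 * (Complex.normSq w * Real.log ‖w‖) := by
    rw [Real.negMulLog, Complex.normSq_eq_norm_sq, Real.log_pow]
    push_cast
    ring
  simp_rw [hent, ← Finset.mul_sum]
  rw [Real.negMulLog]
  linarith

theorem entropy2_eq_sum_negMulLog {α : Type*} [Fintype α] (p : α → ℝ) :
    entropy2 p = (∑ a, Real.negMulLog (p a)) / Real.log 2 := by
  rw [entropy2, Finset.sum_div]
  refine Finset.sum_congr rfl fun a _ => ?_
  rw [Real.logb, Real.negMulLog]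
  ring

/-- A pointwise form of the log-sum inequality. -/
theorem log_sum_term_le {q Q P R : ℝ} (hq : 0 ≤ q) (hqQ : q ≤ Q) (hqP : q ≤ P) (hPR : P ≤ R) :
    q - Q * P / R ≤ q * Real.log q - q * Real.log Q - q * Real.log P + q * Real.log R := by
  rcases hq.eq_or_lt with rfl | hq
  · have : 0 ≤ Q * P / R := div_nonneg (mul_nonneg hqQ hqP) (hqP.trans hPR)
    simpa using this
  have hQ := hq.trans_le hqQ
  have hP := hq.trans_le hqP
  have hR := hP.trans_le hPR
  have h := Real.log_le_sub_one_of_pos (x := Q * P / (R * q)) (by positivity)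
  rw [Real.log_div (by positivity) (by positivity), Real.log_mul hQ.ne' hP.ne',
    Real.log_mul hR.ne' hq.ne'] at h
  have h := mul_le_mul_of_nonneg_left h hq.le
  have : q * (Q * P / (R * q) - 1) = Q * P / R - q := by field_simp
  linarith

/-- Refining the conditioning variable decreases the (unnormalized) conditional entropy. -/
theorem sum_negMulLog_sub_le {κ α : Type*} [Fintype κ] [Fintype α] (q : κ → α → ℝ)
    (hq : ∀ k a, 0 ≤ q k a) :
    ∑ k, (∑ a, Real.negMulLog (q k a) - Real.negMulLog (∑ a, q k a)) ≤
      ∑ a, Real.negMulLog (∑ k, q k a) - Real.negMulLog (∑ a, ∑ k, q k a) := by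
  set Q := fun k => ∑ a, q k a with hQ
  set P := fun a => ∑ k, q k a with hP
  set R := ∑ a, P a with hR
  have hRQ : ∑ k, Q k = R := Finset.sum_comm
  have hP0 (a) : 0 ≤ P a := Finset.sum_nonneg fun k _ => hq k a
  have h := Finset.sum_le_sum fun k (_ : k ∈ Finset.univ) =>
    Finset.sum_le_sum fun a (_ : a ∈ Finset.univ) =>
      log_sum_term_le (hq k a)
        (Finset.single_le_sum (f := q k) (fun a _ => hq k a) (Finset.mem_univ a))
        (Finset.single_le_sum (f := fun k => q k a) (fun k _ => hq k a) (Finset.mem_univ k))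
        (Finset.single_le_sum (f := P) (fun a _ => hP0 a) (Finset.mem_univ a))
  simp_rw [Finset.sum_add_distrib, Finset.sum_sub_distrib] at h
  have e1 : ∑ k, ∑ a, (∑ a, q k a) * P a / R = R := by
    simp_rw [← Finset.sum_div, ← Finset.mul_sum, ← Finset.sum_mul]
    change (∑ k, Q k) * R / R = R
    rw [hRQ, mul_self_div_self]
  have e2 : ∑ k, ∑ a, q k a = R := hRQ
  have e3 : ∑ k, ∑ a, q k a * Real.log (∑ a, q k a) = ∑ k, Q k * Real.log (Q k) := by
    simp_rw [← Finset.sum_mul, hQ]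
  have e4 : ∑ k, ∑ a, q k a * Real.log (∑ k, q k a) = ∑ a, P a * Real.log (P a) := by
    rw [Finset.sum_comm]
    simp_rw [← Finset.sum_mul, hP]
  have e5 : ∑ k, ∑ a, q k a * Real.log R = R * Real.log R := by
    simp_rw [← Finset.sum_mul, e2]
  rw [e1, e2, e3, e4, e5] at h
  simp only [Real.negMulLog_eq_neg, Finset.sum_sub_distrib, Finset.sum_neg_distrib]
  linarith

theorem sum_negMulLog_sub_le_condEntropy2 {β κ α : Type*} [Fintype β] [Fintype κ] [Fintype α]
    (q : β → κ → α → ℝ) (hq : ∀ b k a, 0 ≤ q b k a) :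
    (∑ b, ∑ k, (∑ a, Real.negMulLog (q b k a) - Real.negMulLog (∑ a, q b k a))) / Real.log 2 ≤
      condEntropy2 (fun ba : β × α => ∑ k, q ba.1 k ba.2) := by
  rw [condEntropy2, entropy2_eq_sum_negMulLog, entropy2_eq_sum_negMulLog, ← sub_div,
    Fintype.sum_prod_type, ← Finset.sum_sub_distrib]
  have := Real.log_pos one_lt_two
  gcongr with b _
  exact sum_negMulLog_sub_le (q b) (hq b)

theorem normSq_dotc_comm {n : ℕ} (u v : Fin n → ℂ) :
    Complex.normSq (dotc u v) = Complex.normSq (dotc v u) := by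
  rw [← Complex.normSq_conj (dotc v u)]
  simp [dotc, mul_comm]

theorem dotc_mulVec {k n : ℕ} (A : Matrix (Fin k) (Fin n) ℂ) (u : Fin k → ℂ) (v : Fin n → ℂ) :
    dotc u (A.mulVec v) = dotc (Aᴴ.mulVec u) v := by
  change star u ⬝ᵥ A.mulVec v = star (Aᴴ.mulVec u) ⬝ᵥ v
  rw [Matrix.star_mulVec, Matrix.conjTranspose_conjTranspose, Matrix.dotProduct_mulVec]

/-- The matrix whose columns are the vectors `ψ x`. -/
def colMatrix {n : ℕ} (ψ : Fin n → (Fin n → ℂ)) : Matrix (Fin n) (Fin n) ℂ :=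
  Matrix.of fun i x => ψ x i

theorem conjTranspose_colMatrix_mulVec {n : ℕ} (ψ : Fin n → (Fin n → ℂ)) (w : Fin n → ℂ)
    (x : Fin n) : (colMatrix ψ)ᴴ.mulVec w x = dotc (ψ x) w := rfl

theorem conjTranspose_colMatrix_mul {n : ℕ} (ψ φ : Fin n → (Fin n → ℂ)) (z x : Fin n) :
    ((colMatrix φ)ᴴ * colMatrix ψ) z x = dotc (φ z) (ψ x) := rfl

theorem conjTranspose_colMatrix_mul_self {n : ℕ} {ψ : Fin n → (Fin n → ℂ)}
    (hψ : ∀ x x', dotc (ψ x) (ψ x') = if x = x' then 1 else 0) :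
    (colMatrix ψ)ᴴ * colMatrix ψ = 1 := by
  ext x x'
  rw [conjTranspose_colMatrix_mul, hψ, Matrix.one_apply]

theorem colMatrix_mul_conjTranspose_self {n : ℕ} {ψ : Fin n → (Fin n → ℂ)}
    (hψ : ∀ x x', dotc (ψ x) (ψ x') = if x = x' then 1 else 0) :
    colMatrix ψ * (colMatrix ψ)ᴴ = 1 :=
  mul_eq_one_comm.1 (conjTranspose_colMatrix_mul_self hψ)

/-- Parseval's identity for an orthonormal basis. -/
theorem sum_normSq_dotc {n : ℕ} {ψ : Fin n → (Fin n → ℂ)}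
    (hψ : ∀ x x', dotc (ψ x) (ψ x') = if x = x' then 1 else 0) (w : Fin n → ℂ) :
    ∑ x, Complex.normSq (dotc (ψ x) w) = ∑ i, Complex.normSq (w i) :=
  sum_normSq_mulVec_of_isometry (colMatrix ψ)ᴴ
    (by rw [Matrix.conjTranspose_conjTranspose, colMatrix_mul_conjTranspose_self hψ]) w

theorem sum_normSq_of_orthonormal {n : ℕ} {ψ : Fin n → (Fin n → ℂ)}
    (hψ : ∀ x x', dotc (ψ x) (ψ x') = if x = x' then 1 else 0) (x : Fin n) :
    ∑ i, Complex.normSq (ψ x i) = 1 := by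
  rw [← sum_normSq_dotc hψ (ψ x)]
  simp [hψ]

/-- The Maassen–Uffink relation for a pair of orthonormal bases. -/
theorem maassen_uffink_dotc {n : ℕ} {ψ φ : Fin n → (Fin n → ℂ)}
    (hψ : ∀ x x', dotc (ψ x) (ψ x') = if x = x' then 1 else 0)
    (hφ : ∀ z z', dotc (φ z) (φ z') = if z = z' then 1 else 0) {c : ℝ} (hc : 0 < c)
    (hle : ∀ x z, Complex.normSq (dotc (ψ x) (φ z)) ≤ c) (v : Fin n → ℂ) :
    -(∑ x, Complex.normSq (dotc (ψ x) v)) * Real.log c ≤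
      (∑ x, Real.negMulLog (Complex.normSq (dotc (ψ x) v))
        - Real.negMulLog (∑ x, Complex.normSq (dotc (ψ x) v)))
      + (∑ z, Real.negMulLog (Complex.normSq (dotc (φ z) v))
        - Real.negMulLog (∑ z, Complex.normSq (dotc (φ z) v))) := by
  have hφφ := colMatrix_mul_conjTranspose_self hφ
  have hψψ := conjTranspose_colMatrix_mul_self hψ
  have hψψ' := colMatrix_mul_conjTranspose_self hψ
  have h := maassen_uffink ((colMatrix φ)ᴴ * colMatrix ψ)
    (by rw [Matrix.conjTranspose_mul, Matrix.conjTranspose_conjTranspose, Matrix.mul_assoc,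
      ← Matrix.mul_assoc (colMatrix φ), hφφ, Matrix.one_mul, hψψ]) hc
    (fun z x => by
      rw [conjTranspose_colMatrix_mul, normSq_dotc_comm]
      exact hle x z) ((colMatrix ψ)ᴴ.mulVec v)
  rw [Matrix.mulVec_mulVec, Matrix.mul_assoc, hψψ', Matrix.mul_one] at h
  simp only [conjTranspose_colMatrix_mulVec] at h
  rw [sum_normSq_dotc hφ, ← sum_normSq_dotc hψ v]
  linarith

/-- **Information-theoretic noise–disturbance tradeoff (Theorem 1).**
For any quantum instrument (Kraus operators `K m j`) and any correction operation
(Kraus operators `E m l`), and any two orthonormal bases `ψ`, `φ` of `ℂ^d`,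
`H(X|M) + H(Z|Ẑ) ≥ -log₂ c` where `c = max_{x,z} |⟨ψ^x, φ^z⟩|²`. -/
theorem noise_disturbance_tradeoff
    {d d' : ℕ} (hd : 0 < d)
    {M J L : Type*} [Fintype M] [Fintype J] [Fintype L]
    (ψ φ : Fin d → (Fin d → ℂ))
    (hψ : ∀ x x', dotc (ψ x) (ψ x') = if x = x' then 1 else 0)
    (hφ : ∀ z z', dotc (φ z) (φ z') = if z = z' then 1 else 0)
    (K : M → J → Matrix (Fin d') (Fin d) ℂ)
    (hK : ∑ m, ∑ j, (K m j)ᴴ * K m j = 1)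
    (E : M → L → Matrix (Fin d) (Fin d') ℂ)
    (hE : ∀ m, ∑ l, (E m l)ᴴ * E m l = 1) :
    condEntropy2 (fun mx : M × Fin d =>
        (1 / (d : ℝ)) * ∑ j, ∑ i, Complex.normSq ((K mx.1 j).mulVec (ψ mx.2) i))
      + condEntropy2 (fun zz : Fin d × Fin d =>
        (1 / (d : ℝ)) * ∑ m, ∑ j, ∑ l,
          Complex.normSq (dotc (φ zz.1) ((E m l).mulVec ((K m j).mulVec (φ zz.2)))))
      ≥ - Real.logb 2 (⨆ xz : Fin d × Fin d, Complex.normSq (dotc (ψ xz.1) (φ xz.2))) := by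
  set c := ⨆ xz : Fin d × Fin d, Complex.normSq (dotc (ψ xz.1) (φ xz.2)) with hc_def
  have hle (x z) : Complex.normSq (dotc (ψ x) (φ z)) ≤ c :=
    le_ciSup (f := fun xz : Fin d × Fin d => Complex.normSq (dotc (ψ xz.1) (φ xz.2)))
      (Set.finite_range _).bddAbove (x, z)
  have hc : 0 < c := by
    by_contra! hc
    have h := sum_normSq_dotc hψ (φ ⟨0, hd⟩)
    rw [sum_normSq_of_orthonormal hφ] at h
    linarith [Finset.sum_nonpos fun x (_ : x ∈ Finset.univ) => (hle x ⟨0, hd⟩).trans hc]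
  have hd' : (0 : ℝ) < d := by exact_mod_cast hd
  let q (χ : Fin d → (Fin d → ℂ)) (m : M) (y : Fin d) (j : J) (l : L) (x : Fin d) : ℝ :=
    (1 / (d : ℝ)) *
      Complex.normSq (dotc (φ y) ((E m l).mulVec ((K m j).mulVec (χ x))))
  have hq0 (χ m y j l x) : 0 ≤ q χ m y j l x :=
    mul_nonneg (by positivity) (Complex.normSq_nonneg _)
  let v (m : M) (y : Fin d) (j : J) (l : L) : Fin d → ℂ :=
    ((√(d : ℝ))⁻¹ : ℂ) • (K m j)ᴴ.mulVec ((E m l)ᴴ.mulVec (φ y))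
  have hv (χ m y j l x) : Complex.normSq (dotc (χ x) (v m y j l)) = q χ m y j l x := by
    have hsmul (r : ℂ) (u w : Fin d → ℂ) : dotc u (r • w) = r * dotc u w := by
      simp [dotc, Finset.mul_sum, mul_left_comm]
    simp only [v, q]
    rw [hsmul, Complex.normSq_mul, normSq_dotc_comm, dotc_mulVec, dotc_mulVec, ← Complex.ofReal_inv,
      Complex.normSq_ofReal, ← mul_inv, Real.mul_self_sqrt hd'.le, one_div]
  have hN : (fun mx : M × Fin d =>
        (1 / (d : ℝ)) * ∑ j, ∑ i, Complex.normSq ((K mx.1 j).mulVec (ψ mx.2) i))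
      = fun mx => ∑ k : Fin d × J × L, q ψ mx.1 k.1 k.2.1 k.2.2 mx.2 := by
    funext ⟨m, x⟩
    simp only [q]
    rw [← Finset.mul_sum, Fintype.sum_prod_type_right, Fintype.sum_prod_type]
    congr 1
    refine Finset.sum_congr rfl fun j _ => ?_
    rw [← sum_normSq_mulVec (E m) (hE m)]
    exact Finset.sum_congr rfl fun l _ => (sum_normSq_dotc hφ _).symm
  have hD : (fun zz : Fin d × Fin d =>
        (1 / (d : ℝ)) * ∑ m, ∑ j, ∑ l,
          Complex.normSq (dotc (φ zz.1) ((E m l).mulVec ((K m j).mulVec (φ zz.2)))))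
      = fun zz => ∑ k : M × J × L, q φ k.1 zz.1 k.2.1 k.2.2 zz.2 := by
    funext zz
    simp only [q, Fintype.sum_prod_type, Finset.mul_sum]
  have htotal : ∑ m, ∑ k : Fin d × J × L, ∑ x, q ψ m k.1 k.2.1 k.2.2 x = 1 := by
    have h (m) : ∑ k : Fin d × J × L, ∑ x, q ψ m k.1 k.2.1 k.2.2 x
        = ∑ x, (1 / (d : ℝ)) * ∑ j, ∑ i, Complex.normSq ((K m j).mulVec (ψ x) i) := by
      rw [Finset.sum_comm]
      exact Finset.sum_congr rfl fun x _ => (congrFun hN (m, x)).symm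
    have hK' : ∑ k : M × J, (K k.1 k.2)ᴴ * K k.1 k.2 = 1 := by rwa [Fintype.sum_prod_type]
    simp_rw [h, ← Finset.mul_sum]
    rw [Finset.sum_comm]
    have h1 (x) : ∑ m, ∑ j, ∑ i, Complex.normSq ((K m j).mulVec (ψ x) i) = 1 := by
      rw [← sum_normSq_of_orthonormal hψ x, ← sum_normSq_mulVec _ hK' (ψ x),
        Fintype.sum_prod_type]
    simp [h1, hd'.ne']
  rw [hN, hD]
  have hX := sum_negMulLog_sub_le_condEntropy2
    (fun m (k : Fin d × J × L) x => q ψ m k.1 k.2.1 k.2.2 x) fun _ _ _ => hq0 ..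
  have hZ := sum_negMulLog_sub_le_condEntropy2
    (fun y (k : M × J × L) z => q φ k.1 y k.2.1 k.2.2 z) fun _ _ _ => hq0 ..
  refine ge_iff_le.2 (le_trans ?_ (add_le_add hX hZ))
  rw [← add_div, Real.logb, ← neg_div]
  have := Real.log_pos one_lt_two
  gcongr
  have hswap (f : M → Fin d → J → L → ℝ) :
      ∑ y, ∑ k : M × J × L, f k.1 y k.2.1 k.2.2
        = ∑ m, ∑ k : Fin d × J × L, f m k.1 k.2.1 k.2.2 := by
    simp_rw [Fintype.sum_prod_type]
    exact Finset.sum_comm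
  rw [hswap fun m y j l => ∑ z, Real.negMulLog (q φ m y j l z)
      - Real.negMulLog (∑ z, q φ m y j l z)]
  simp_rw [← Finset.sum_add_distrib]
  rw [← one_mul (Real.log c), ← neg_mul, ← htotal]
  simp_rw [← Finset.sum_neg_distrib, Finset.sum_mul]
  refine Finset.sum_le_sum fun m _ => Finset.sum_le_sum fun k _ => ?_
  have h := maassen_uffink_dotc hψ hφ hc hle (v m k.1 k.2.1 k.2.2)
  simp only [hv ψ, hv φ] at h
  simpa only [← Finset.sum_neg_distrib, Finset.sum_mul] using h
end

section
/- Joint-measurement tradeoff (Eq. (5)). Let d ≥ 1, let {ψ^x}_{x ∈ Fin d} and {φ^z}_{z ∈ Fin d} be two orthonormal bases of ℂ^d, and let {Π_u}_{u ∈ U} be a POVM on ℂ^d (U finite, each Π_u positive semidefinite, ∑_{u∈U} Π_u = 1). Define the joint distributions p(u,x) := (1/d) ⟨ψ^x, Π_u ψ^x⟩ and q(u,z) := (1/d) ⟨φ^z, Π_u φ^z⟩. Then H(X|U) + H(Z|U) ≥ −log₂ c, where H(X|U) is the conditional entropy of x given u computed from p, H(Z|U) is the conditional entropy of z given u computed from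 q, and c := max_{x,z} |⟨ψ^x, φ^z⟩|². -/
open scoped BigOperators Matrix ComplexOrder

theorem hasDerivAt_re_le_of_le_of_eq {F : ℂ → ℂ} {F' : ℂ} {g : ℝ → ℝ} {g' : ℝ}
    (hF : HasDerivAt F F' 0) (hg : HasDerivAt g g' 0) (h0 : (F 0).re = g 0)
    (hle : ∀ r ∈ Set.Icc (0 : ℝ) 1, (F r).re ≤ g r) : F'.re ≤ g' := by
  have hF0 : HasDerivAt F F' ((0 : ℝ) : ℂ) := by simpa using hF
  have hre : HasDerivAt (fun r : ℝ => (F r).re) F'.re 0 := hF0.real_of_complex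
  have hsub := (hg.sub hre).hasDerivWithinAt (s := Set.Ioi 0)
  rw [hasDerivWithinAt_iff_tendsto_slope' (by simp)] at hsub
  have : 0 ≤ g' - F'.re := by
    refine ge_of_tendsto hsub ?_
    filter_upwards [Ioo_mem_nhdsGT (zero_lt_one (α := ℝ))] with r hr
    have := hle r ⟨hr.1.le, hr.2.le⟩
    simp only [slope_def_field, Pi.sub_apply, Complex.ofReal_zero, h0, sub_self, sub_zero]
    exact div_nonneg (by linarith) hr.1.le
  linarith

/-- An entropic uncertainty bound for a complex coupling `w` of `p` and `q`, obtained by applying the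
three-lines theorem to `∑ x z, (p x * q z) ^ (s / 2) * w x z` and differentiating at `s = 0`. -/
theorem entropy_sum_bound_of_coupling {α β : Type*} [Fintype α] [Fintype β]
    {p : α → ℝ} {q : β → ℝ} {w : α → β → ℂ} {t k : ℝ}
    (hp : ∀ x, 0 ≤ p x) (hq : ∀ z, 0 ≤ q z) (hk : 0 ≤ k)
    (hwp : ∀ x, ∑ z, w x z = p x) (hwq : ∀ z, ∑ x, w x z = q z)
    (hpt : ∑ x, p x = t) (hqt : ∑ z, q z = t)
    (hw : ∀ x z, ‖w x z‖ ≤ k * (√(p x) * √(q z)))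
    (hphase : ∀ (u : α → ℂ) (v : β → ℂ), (∀ x, ‖u x‖ = 1) → (∀ z, ‖v z‖ = 1) →
      ‖∑ x, ∑ z, u x * v z * w x z‖ ≤ t) :
    ∑ x, p x * Real.log (p x) + ∑ z, q z * Real.log (q z)
      ≤ 2 * (t * Real.log k + t * Real.log t) := by
  have ht0 : 0 ≤ t := hpt ▸ Finset.sum_nonneg fun x _ => hp x
  rcases ht0.eq_or_lt with rfl | ht
  · have hp0 : ∀ x, p x = 0 := by
      simpa using (Finset.sum_eq_zero_iff_of_nonneg fun x _ => hp x).1 hpt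
    have hq0 : ∀ z, q z = 0 := by
      simpa using (Finset.sum_eq_zero_iff_of_nonneg fun z _ => hq z).1 hqt
    simp [hp0, hq0]
  have hwt : ∑ x, ∑ z, w x z = t := by simp [hwp, ← hpt]
  rcases hk.eq_or_lt with rfl | hk
  · have hw0 : ∀ x z, w x z = 0 := by simpa using hw
    simp only [hw0, Finset.sum_const_zero] at hwt
    exact absurd (by exact_mod_cast hwt.symm) ht.ne'
  let L : α → β → ℂ := fun x z => ((Real.log (p x) + Real.log (q z)) / 2 : ℝ)
  let F : ℂ → ℂ := fun s => ∑ x, ∑ z, Complex.exp (s * L x z) * w x z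
  have hFder : ∀ s, HasDerivAt F (∑ x, ∑ z, Complex.exp (s * L x z) * L x z * w x z) s := by
    intro s
    refine HasDerivAt.fun_sum fun x _ => HasDerivAt.fun_sum fun z _ => ?_
    simpa using (((hasDerivAt_id s).mul_const (L x z)).cexp).mul_const (w x z)
  have hnorm : ∀ s x z, ‖Complex.exp (s * L x z)‖
      = Real.exp (s.re * ((Real.log (p x) + Real.log (q z)) / 2)) := by
    intro s x z
    rw [Complex.norm_exp, Complex.re_mul_ofReal]
  have hbdd : BddAbove ((norm ∘ F) '' Complex.HadamardThreeLines.verticalClosedStrip 0 1) := by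
    refine ⟨∑ x, ∑ z, Real.exp |(Real.log (p x) + Real.log (q z)) / 2| * ‖w x z‖, ?_⟩
    rintro _ ⟨s, hs, rfl⟩
    refine (norm_sum_le _ _).trans (Finset.sum_le_sum fun x _ =>
      (norm_sum_le _ _).trans (Finset.sum_le_sum fun z _ => ?_))
    rw [norm_mul, hnorm]
    gcongr
    have hs' : 0 ≤ s.re ∧ s.re ≤ 1 := hs
    refine (le_abs_self _).trans ?_
    rw [abs_mul, abs_of_nonneg hs'.1]
    exact mul_le_of_le_one_left (abs_nonneg _) hs'.2
  have hleft : ∀ s ∈ Complex.re ⁻¹' {0}, ‖F s‖ ≤ t := by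
    intro s hs
    have hs : s.re = 0 := hs
    have key := hphase (fun x => Complex.exp (s * (Real.log (p x) / 2 : ℝ)))
      (fun z => Complex.exp (s * (Real.log (q z) / 2 : ℝ)))
      (fun x => by rw [Complex.norm_exp, Complex.re_mul_ofReal, hs]; simp)
      (fun z => by rw [Complex.norm_exp, Complex.re_mul_ofReal, hs]; simp)
    convert key using 6 with x _ z _
    rw [← Complex.exp_add, ← mul_add, ← Complex.ofReal_add, ← add_div]
  have hright : ∀ s ∈ Complex.re ⁻¹' {1}, ‖F s‖ ≤ k * t ^ 2 := by
    intro s hs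
    have hs : s.re = 1 := hs
    have hsum : k * t ^ 2 = ∑ x, ∑ z, k * (p x * q z) := by
      simp_rw [← Finset.mul_sum, hqt, ← Finset.sum_mul, hpt]; ring
    rw [hsum]
    refine (norm_sum_le _ _).trans (Finset.sum_le_sum fun x _ =>
      (norm_sum_le _ _).trans (Finset.sum_le_sum fun z _ => ?_))
    rw [norm_mul, hnorm, hs, one_mul]
    have hwxz := hw x z
    rcases (hp x).eq_or_lt with hpx | hpx
    · rw [← hpx] at hwxz ⊢
      have : ‖w x z‖ = 0 := le_antisymm (by simpa using hwxz) (norm_nonneg _)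
      simp [this]
    rcases (hq z).eq_or_lt with hqz | hqz
    · rw [← hqz] at hwxz ⊢
      have : ‖w x z‖ = 0 := le_antisymm (by simpa using hwxz) (norm_nonneg _)
      simp [this]
    have hexp : Real.exp ((Real.log (p x) + Real.log (q z)) / 2) = √(p x) * √(q z) := by
      rw [add_div, Real.exp_add, ← Real.log_sqrt hpx.le, ← Real.log_sqrt hqz.le,
        Real.exp_log (Real.sqrt_pos.2 hpx), Real.exp_log (Real.sqrt_pos.2 hqz)]
    rw [hexp]
    calc √(p x) * √(q z) * ‖w x z‖
        ≤ √(p x) * √(q z) * (k * (√(p x) * √(q z))) := by gcongr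
      _ = k * ((√(p x) * √(p x)) * (√(q z) * √(q z))) := by ring
      _ = k * (p x * q z) := by
          rw [Real.mul_self_sqrt hpx.le, Real.mul_self_sqrt hqz.le]
  have hinterp : ∀ r ∈ Set.Icc (0 : ℝ) 1,
      (F r).re ≤ t * Real.exp (r * (Real.log k + Real.log t)) := by
    intro r hr
    have h3 := Complex.HadamardThreeLines.norm_le_interp_of_mem_verticalClosedStrip₀₁' (f := F)
      (z := (r : ℂ)) (by simpa [Complex.HadamardThreeLines.verticalClosedStrip] using hr)
      (Differentiable.diffContOnCl fun s => (hFder s).differentiableAt) hbdd hleft hright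
    refine (Complex.re_le_norm _).trans (h3.trans_eq ?_)
    rw [Complex.ofReal_re, Real.rpow_def_of_pos ht, Real.rpow_def_of_pos (by positivity),
      Real.log_mul hk.ne' (by positivity), Real.log_pow, ← Real.exp_add]
    conv_rhs => rw [← Real.exp_log ht, ← Real.exp_add, Real.exp_log ht]
    congr 1
    push_cast
    ring
  have hg : HasDerivAt (fun r : ℝ => t * Real.exp (r * (Real.log k + Real.log t)))
      (t * (Real.log k + Real.log t)) 0 := by
    simpa using
      (((hasDerivAt_id (0 : ℝ)).mul_const (Real.log k + Real.log t)).exp).const_mul t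
  have hmain := hasDerivAt_re_le_of_le_of_eq (hFder 0) hg (by simp [F, hwt]) hinterp
  have hder : ∑ x, ∑ z, Complex.exp (0 * L x z) * L x z * w x z
      = ((∑ x, p x * Real.log (p x) + ∑ z, q z * Real.log (q z)) / 2 : ℝ) := by
    have hsplit : ∀ x z, Complex.exp (0 * L x z) * L x z * w x z
        = (Real.log (p x) / 2 : ℝ) * w x z + (Real.log (q z) / 2 : ℝ) * w x z := by
      intro x z
      simp only [L, zero_mul, Complex.exp_zero]
      push_cast
      ring
    simp_rw [hsplit, Finset.sum_add_distrib]
    rw [Finset.sum_comm (f := fun x z => ((Real.log (q z) / 2 : ℝ) : ℂ) * w x z)]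
    simp_rw [← Finset.mul_sum, hwp, hwq]
    push_cast
    rw [add_div, Finset.sum_div, Finset.sum_div]
    congr 1 <;> exact Finset.sum_congr rfl fun _ _ => by ring
  rw [hder, Complex.ofReal_re] at hmain
  linarith

theorem Matrix.PosSemidef.norm_trace_mul_unitary_le {n : Type*} [Fintype n] [DecidableEq n]
    {P : Matrix n n ℂ} (hP : P.PosSemidef) {W : Matrix n n ℂ} (hW : W * Wᴴ = 1) :
    ‖(P * W).trace‖ ≤ P.trace.re := by
  have hre : ∀ V : Matrix n n ℂ, V * Vᴴ = 1 → (P * V).trace.re ≤ P.trace.re := by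
    intro V hV
    have h0 := (Complex.nonneg_iff.1 (hP.mul_mul_conjTranspose_same (1 - Vᴴ)).trace_nonneg).1
    have hexp : ((1 - Vᴴ) * P * (1 - Vᴴ)ᴴ).trace
        = P.trace + P.trace - (P * V).trace - star (P * V).trace := by
      rw [← Matrix.trace_conjTranspose, Matrix.conjTranspose_mul, hP.isHermitian.eq,
        Matrix.conjTranspose_sub, Matrix.conjTranspose_one, Matrix.conjTranspose_conjTranspose]
      simp only [sub_mul, mul_sub, one_mul, mul_one, Matrix.trace_sub]
      rw [Matrix.mul_assoc Vᴴ P V, Matrix.trace_mul_comm Vᴴ (P * V), Matrix.mul_assoc P V, hV,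
        mul_one]
      ring
    rw [hexp] at h0
    simp only [Complex.sub_re, Complex.add_re, Complex.star_def, Complex.conj_re] at h0
    linarith
  by_cases h : (P * W).trace = 0
  · rw [h, norm_zero]
    exact (Complex.nonneg_iff.1 hP.trace_nonneg).1
  have hn : (‖(P * W).trace‖ : ℂ) ≠ 0 := by simpa using h
  have hc : star (P * W).trace * (P * W).trace = (‖(P * W).trace‖ : ℂ) ^ 2 := by
    rw [Complex.star_def, Complex.conj_mul']
  have := hre ((star (P * W).trace / (‖(P * W).trace‖ : ℂ)) • W) (by
    rw [Matrix.conjTranspose_smul, Matrix.smul_mul, Matrix.mul_smul, hW, smul_smul]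
    have : star (P * W).trace / (‖(P * W).trace‖ : ℂ)
        * star (star (P * W).trace / (‖(P * W).trace‖ : ℂ)) = 1 := by
      simp only [Complex.star_def, map_div₀, Complex.conj_conj, Complex.conj_ofReal]
      rw [div_mul_div_comm, ← Complex.star_def, hc]
      field_simp
    rw [this, one_smul])
  rw [Matrix.mul_smul, Matrix.trace_smul, smul_eq_mul, div_mul_eq_mul_div, hc, sq,
    mul_div_assoc, div_self hn, mul_one, Complex.ofReal_re] at this
  exact this

open scoped MatrixOrder in
theorem Matrix.PosSemidef.norm_apply_le_sqrt_mul_sqrt {m n : Type*} [Fintype m] [Fintype n]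
    [DecidableEq n] {P : Matrix n n ℂ} (hP : P.PosSemidef) (A : Matrix n m ℂ)
    (B : Matrix n m ℂ) (x z : m) :
    ‖(Aᴴ * P * B) x z‖ ≤ √((Aᴴ * P * A) x x).re * √((Bᴴ * P * B) z z).re := by
  obtain ⟨K, rfl⟩ := CStarAlgebra.nonneg_iff_eq_star_mul_self.1 hP.nonneg
  rw [Matrix.star_eq_conjTranspose]
  have key : ∀ (C D : Matrix n m ℂ) (i j : m), (Cᴴ * (Kᴴ * K) * D) i j
      = inner ℂ (WithLp.toLp 2 ((K * C).col i)) (WithLp.toLp 2 ((K * D).col j)) := by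
    intro C D i j
    rw [← Matrix.mul_assoc, Matrix.mul_assoc, ← Matrix.conjTranspose_mul, Matrix.mul_apply]
    simp [PiLp.inner_apply, mul_comm]
  rw [key, key, key]
  have hs : ∀ v : EuclideanSpace ℂ n, √(inner ℂ v v).re = ‖v‖ := fun v =>
    (norm_eq_sqrt_re_inner (𝕜 := ℂ) v).symm
  rw [hs, hs]
  exact norm_inner_le_norm _ _

/-- The Maassen–Uffink uncertainty relation for an unnormalized density matrix `P`. -/
theorem Matrix.PosSemidef.entropy_sum_bound {n : Type*} [Fintype n] [DecidableEq n]
    {P A B : Matrix n n ℂ} (hP : P.PosSemidef) (hA : Aᴴ * A = 1) (hB : Bᴴ * B = 1) {k : ℝ}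
    (hk : 0 ≤ k) (hM : ∀ x z, ‖(Aᴴ * B) x z‖ ≤ k) :
    ∑ x, ((Aᴴ * P * A) x x).re * Real.log ((Aᴴ * P * A) x x).re
      + ∑ z, ((Bᴴ * P * B) z z).re * Real.log ((Bᴴ * P * B) z z).re
      ≤ 2 * (P.trace.re * Real.log k + P.trace.re * Real.log P.trace.re) := by
  have hA' : A * Aᴴ = 1 := mul_eq_one_comm.1 hA
  have hB' : B * Bᴴ = 1 := mul_eq_one_comm.1 hB
  have hdiag : ∀ (C : Matrix n n ℂ) x, 0 ≤ (Cᴴ * P * C) x x := fun C x =>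
    (hP.conjTranspose_mul_mul_same C).diag_nonneg
  have hreal : ∀ (C : Matrix n n ℂ) x,
      (((Cᴴ * P * C) x x).re : ℂ) = (Cᴴ * P * C) x x := fun C x =>
    (Complex.eq_re_of_ofReal_le (r := 0) (by simpa using hdiag C x)).symm
  have htrace : ∀ C : Matrix n n ℂ, C * Cᴴ = 1 →
      ∑ x, ((Cᴴ * P * C) x x).re = P.trace.re := by
    intro C hC
    rw [← Complex.re_sum]
    change (Cᴴ * P * C).trace.re = _
    rw [Matrix.trace_mul_comm, ← Matrix.mul_assoc, hC, one_mul]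
  refine entropy_sum_bound_of_coupling (k := k)
    (w := fun x z => (Aᴴ * P * B) x z * (Bᴴ * A) z x)
    (fun x => (Complex.nonneg_iff.1 (hdiag A x)).1)
    (fun z => (Complex.nonneg_iff.1 (hdiag B z)).1) hk ?_ ?_ (htrace A hA') (htrace B hB') ?_ ?_
  · intro x
    rw [hreal, ← Matrix.mul_apply, Matrix.mul_assoc, ← Matrix.mul_assoc B, hB', one_mul]
  · intro z
    simp_rw [mul_comm ((Aᴴ * P * B) _ z)]
    rw [hreal, ← Matrix.mul_apply, Matrix.mul_assoc Aᴴ, Matrix.mul_assoc Bᴴ,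
      ← Matrix.mul_assoc A, hA', one_mul, Matrix.mul_assoc]
  · intro x z
    have hzx : ‖(Bᴴ * A) z x‖ ≤ k := by
      have : Bᴴ * A = (Aᴴ * B)ᴴ := by simp
      rw [this, Matrix.conjTranspose_apply, norm_star]
      exact hM x z
    rw [norm_mul, mul_comm k]
    exact mul_le_mul (hP.norm_apply_le_sqrt_mul_sqrt A B x z) hzx (norm_nonneg _)
      (by positivity)
  · intro u v hu hv
    have hdiagonal : ∀ s : n → ℂ, (∀ i, ‖s i‖ = 1) →
        Matrix.diagonal s * (Matrix.diagonal s)ᴴ = 1 := by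
      intro s hs
      rw [Matrix.diagonal_conjTranspose, Matrix.diagonal_mul_diagonal, ← Matrix.diagonal_one]
      congr 1
      ext i
      simp [Complex.mul_conj', hs]
    have hsum : ∑ x, ∑ z, u x * v z * ((Aᴴ * P * B) x z * (Bᴴ * A) z x)
        = (P * (B * Matrix.diagonal v * Bᴴ * A * Matrix.diagonal u * Aᴴ)).trace := by
      have hcycle : (P * (B * Matrix.diagonal v * Bᴴ * A * Matrix.diagonal u * Aᴴ)).trace
          = (Aᴴ * P * B * Matrix.diagonal v * (Bᴴ * A * Matrix.diagonal u)).trace := by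
        rw [← Matrix.mul_assoc, Matrix.trace_mul_comm]
        simp only [Matrix.mul_assoc]
      rw [hcycle]
      refine Finset.sum_congr rfl fun x _ => ?_
      rw [Matrix.diag_apply, Matrix.mul_apply]
      refine Finset.sum_congr rfl fun z _ => ?_
      rw [Matrix.mul_diagonal, Matrix.mul_diagonal]
      ring
    rw [hsum]
    refine hP.norm_trace_mul_unitary_le ?_
    have hmul : ∀ V W : Matrix n n ℂ, V * Vᴴ = 1 → W * Wᴴ = 1 → V * W * (V * W)ᴴ = 1 := by
      intro V W hV hW
      rw [Matrix.conjTranspose_mul, Matrix.mul_assoc, ← Matrix.mul_assoc W, hW, one_mul, hV]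
    exact hmul _ _ (hmul _ _ (hmul _ _ (hmul _ _ (hmul _ _ hB' (hdiagonal v hv))
      (by simpa using hB)) hA') (hdiagonal u hu)) (by simpa using hA)

theorem condEntropy2_eq {β α : Type*} [Fintype β] [Fintype α] (p : β × α → ℝ) :
    condEntropy2 p = (∑ b, ((∑ a, p (b, a)) * Real.log (∑ a, p (b, a))
      - ∑ a, p (b, a) * Real.log (p (b, a)))) / Real.log 2 := by
  simp only [condEntropy2, entropy2, Fintype.sum_prod_type, Real.logb, ← mul_div_assoc,
    Finset.sum_neg_distrib, ← Finset.sum_div, Finset.sum_sub_distrib]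
  ring

/-- **Joint-measurement tradeoff (Eq. (5)).** For a POVM `{Pov_u}` on `ℂ^d` and two
orthonormal bases `ψ`, `φ`, the conditional entropies of the induced joint distributions
satisfy `H(X|U) + H(Z|U) ≥ -log₂ c` with `c = max_{x,z} |⟨ψ^x, φ^z⟩|²`. -/
theorem joint_measurement_tradeoff
    {d : ℕ} (hd : 0 < d)
    {U : Type*} [Fintype U]
    (ψ φ : Fin d → (Fin d → ℂ))
    (hψ : ∀ x x', dotc (ψ x) (ψ x') = if x = x' then 1 else 0)
    (hφ : ∀ z z', dotc (φ z) (φ z') = if z = z' then 1 else 0)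
    (Pov : U → Matrix (Fin d) (Fin d) ℂ)
    (hPovpos : ∀ u, (Pov u).PosSemidef)
    (hPovsum : ∑ u, Pov u = 1) :
    condEntropy2 (fun ux : U × Fin d =>
        (1 / (d : ℝ)) * (dotc (ψ ux.2) ((Pov ux.1).mulVec (ψ ux.2))).re)
      + condEntropy2 (fun uz : U × Fin d =>
        (1 / (d : ℝ)) * (dotc (φ uz.2) ((Pov uz.1).mulVec (φ uz.2))).re)
      ≥ - Real.logb 2 (⨆ xz : Fin d × Fin d, Complex.normSq (dotc (ψ xz.1) (φ xz.2))) := by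
  let A : Matrix (Fin d) (Fin d) ℂ := Matrix.of fun i x => ψ x i
  let B : Matrix (Fin d) (Fin d) ℂ := Matrix.of fun i z => φ z i
  have hA : Aᴴ * A = 1 := by
    ext x x'
    rw [Matrix.one_apply, ← hψ x x']
    rfl
  have hB : Bᴴ * B = 1 := by
    ext z z'
    rw [Matrix.one_apply, ← hφ z z']
    rfl
  set c : ℝ := ⨆ xz : Fin d × Fin d, Complex.normSq (dotc (ψ xz.1) (φ xz.2)) with hc
  have hM : ∀ x z, ‖(Aᴴ * B) x z‖ ≤ √c := by
    intro x z
    refine Real.le_sqrt_of_sq_le ?_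
    rw [← Complex.normSq_eq_norm_sq]
    exact le_ciSup (f := fun xz : Fin d × Fin d => Complex.normSq (dotc (ψ xz.1) (φ xz.2)))
      (Set.finite_range _).bddAbove (x, z)
  have hc0 : 0 ≤ c := Real.iSup_nonneg fun _ => Complex.normSq_nonneg _
  let Q : U → Matrix (Fin d) (Fin d) ℂ := fun u => ((1 / d : ℝ) : ℂ) • Pov u
  have hQ : ∀ u, (Q u).PosSemidef := fun u =>
    (hPovpos u).smul (Complex.zero_le_real.2 (by positivity))
  have hentry : ∀ (χ : Fin d → Fin d → ℂ) (u : U) (x : Fin d),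
      (1 / (d : ℝ)) * (dotc (χ x) ((Pov u).mulVec (χ x))).re
        = (((Matrix.of fun i x => χ x i)ᴴ * Q u * (Matrix.of fun i x => χ x i)) x x).re := by
    intro χ u x
    rw [Matrix.mul_smul, Matrix.smul_mul, Matrix.smul_apply, smul_eq_mul, Complex.re_ofReal_mul,
      Matrix.mul_assoc]
    rfl
  have htr : ∀ C : Matrix (Fin d) (Fin d) ℂ, Cᴴ * C = 1 → ∀ u,
      ∑ x, ((Cᴴ * Q u * C) x x).re = (Q u).trace.re := by
    intro C hC u
    rw [← Complex.re_sum]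
    change (Cᴴ * Q u * C).trace.re = _
    rw [Matrix.trace_mul_comm, ← Matrix.mul_assoc, mul_eq_one_comm.1 hC, one_mul]
  have htotal : ∑ u, (Q u).trace.re = 1 := by
    rw [← Complex.re_sum, ← Matrix.trace_sum, ← Finset.smul_sum, hPovsum, Matrix.trace_smul,
      Matrix.trace_one, Fintype.card_fin, smul_eq_mul, Complex.re_ofReal_mul, Complex.natCast_re]
    field_simp
  have hbound : ∀ u, -((Q u).trace.re * Real.log c) ≤
      ((Q u).trace.re * Real.log (Q u).trace.re
        - ∑ x, ((Aᴴ * Q u * A) x x).re * Real.log ((Aᴴ * Q u * A) x x).re)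
      + ((Q u).trace.re * Real.log (Q u).trace.re
        - ∑ z, ((Bᴴ * Q u * B) z z).re * Real.log ((Bᴴ * Q u * B) z z).re) := by
    intro u
    have := (hQ u).entropy_sum_bound hA hB (Real.sqrt_nonneg c) hM
    rw [Real.log_sqrt hc0] at this
    linarith
  simp only [condEntropy2_eq, hentry]
  change _ ≤ _
  rw [← add_div, ← Finset.sum_add_distrib, Real.logb, ← neg_div]
  refine div_le_div_of_nonneg_right ?_ (Real.log_pos one_lt_two).le
  calc -Real.log c = ∑ u, -((Q u).trace.re * Real.log c) := by
        rw [Finset.sum_neg_distrib, ← Finset.sum_mul, htotal, one_mul]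
    _ ≤ _ := Finset.sum_le_sum fun u _ => by
        rw [htr _ hA, htr _ hB]
        exact hbound u
end

section
/- Entropic lower bound on mean square estimation error for lattice-valued variables. Let M and Fin n be finite sets, let p(m,x) be a joint probability distribution on M × Fin n, and let ξ : Fin n → ℝ be injective with every difference ξ(x) − ξ(x') an integer multiple of some s > 0. Then for every estimator f : M → ℝ, ∑_{m,x} p(m,x) (f(m) − ξ(x))² + s²/12 ≥ (s²/(2π e)) · 2^{2 H(X|M)}, where H(X|M) is the conditional entropy (base 2) of x given m computed from p. -/
open scoped BigOperators

open MeasureTheory Set in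
/-- Jensen's inequality for a Gaussian weight averaged over an interval of length `s`. -/
theorem mul_exp_mean_le_setIntegral_gaussian (a b c s : ℝ) (hs : 0 ≤ s) :
    s * Real.exp (-b * ((a - c) ^ 2 + s ^ 2 / 12))
      ≤ ∫ y in Ioc (a - s / 2) (a + s / 2), Real.exp (-b * (y - c) ^ 2) := by
  set t := -b * ((a - c) ^ 2 + s ^ 2 / 12) with ht
  rw [← intervalIntegral.integral_of_le (by linarith)]
  have hlin : ∫ y in (a - s / 2)..(a + s / 2),
      Real.exp t * (-b * (y - c) ^ 2 - t + 1) = s * Real.exp t := by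
    have hd : ∀ y ∈ uIcc (a - s / 2) (a + s / 2),
        HasDerivAt (fun y => Real.exp t * (-b * ((y - c) ^ 3 / 3) - t * y + y))
          (Real.exp t * (-b * (y - c) ^ 2 - t + 1)) y := by
      intro y _
      have h3 : HasDerivAt (fun y => (y - c) ^ 3 / 3) ((y - c) ^ 2) y := by
        refine ((((hasDerivAt_id' y).sub_const c).pow 3).div_const 3).congr_deriv ?_
        push_cast
        ring
      exact ((((h3.const_mul (-b)).sub ((hasDerivAt_id' y).const_mul t)).add
        (hasDerivAt_id' y)).const_mul (Real.exp t)).congr_deriv (by ring)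
    rw [intervalIntegral.integral_eq_sub_of_hasDerivAt hd
      (Continuous.intervalIntegrable (by fun_prop) _ _), ht]
    ring
  rw [← hlin]
  refine intervalIntegral.integral_mono_on (by linarith)
    (Continuous.intervalIntegrable (by fun_prop) _ _)
    (Continuous.intervalIntegrable (by fun_prop) _ _) fun y _ => ?_
  calc Real.exp t * (-b * (y - c) ^ 2 - t + 1)
      ≤ Real.exp t * Real.exp (-b * (y - c) ^ 2 - t) :=
        mul_le_mul_of_nonneg_left (Real.add_one_le_exp _) (Real.exp_pos _).le
    _ = Real.exp (-b * (y - c) ^ 2) := by rw [← Real.exp_add]; congr 1; ring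

open MeasureTheory Set in
/-- A Gaussian sum over `s`-separated points is bounded by the Gaussian integral. -/
theorem sum_mul_exp_le_sqrt_of_separated {ι : Type*} [Fintype ι] (ξ : ι → ℝ) (b c s : ℝ)
    (hb : 0 < b) (hs : 0 ≤ s) (hsep : ∀ x y, x ≠ y → s ≤ |ξ x - ξ y|) :
    ∑ x, s * Real.exp (-b * ((ξ x - c) ^ 2 + s ^ 2 / 12)) ≤ Real.sqrt (Real.pi / b) := by
  have hint : Integrable fun y : ℝ => Real.exp (-b * (y - c) ^ 2) :=
    (integrable_exp_neg_mul_sq hb).comp_sub_right c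
  have hdisj : Pairwise (Function.onFun Disjoint
      fun x => Ioc (ξ x - s / 2) (ξ x + s / 2)) := by
    intro x y hxy
    refine Set.disjoint_left.2 fun z hx hy => ?_
    have := hsep x y hxy
    rcases le_abs.1 this with h | h <;> linarith [hx.1, hx.2, hy.1, hy.2]
  calc ∑ x, s * Real.exp (-b * ((ξ x - c) ^ 2 + s ^ 2 / 12))
      ≤ ∑ x, ∫ y in Ioc (ξ x - s / 2) (ξ x + s / 2), Real.exp (-b * (y - c) ^ 2) :=
        Finset.sum_le_sum fun x _ => mul_exp_mean_le_setIntegral_gaussian _ _ _ _ hs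
    _ = ∫ y in ⋃ x, Ioc (ξ x - s / 2) (ξ x + s / 2), Real.exp (-b * (y - c) ^ 2) :=
        (integral_iUnion_fintype (fun _ => measurableSet_Ioc) hdisj
          fun _ => hint.integrableOn).symm
    _ ≤ ∫ y, Real.exp (-b * (y - c) ^ 2) :=
        setIntegral_le_integral hint (Filter.Eventually.of_forall fun _ => (Real.exp_pos _).le)
    _ = Real.sqrt (Real.pi / b) := by
        rw [integral_sub_right_eq_self (fun y => Real.exp (-b * y ^ 2)) c, integral_gaussian]

/-- Gibbs' inequality for conditional entropy, in natural units, with sub-normalized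
positive conditional weights `r`. -/
theorem condEntropy2_mul_log_two_le {M ι : Type*} [Fintype M] [Fintype ι] (p : M × ι → ℝ)
    (hp : ∀ q, 0 ≤ p q) (r : M → ι → ℝ) (hr : ∀ m x, 0 < r m x) (hr1 : ∀ m, ∑ x, r m x ≤ 1) :
    condEntropy2 p * Real.log 2 ≤ -∑ m, ∑ x, p (m, x) * Real.log (r m x) := by
  have hlog2 : Real.log 2 ≠ 0 := (Real.log_pos one_lt_two).ne'
  set P : M → ℝ := fun m => ∑ x, p (m, x) with hP
  have hP0 : ∀ m, 0 ≤ P m := fun m => Finset.sum_nonneg fun x _ => hp _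
  have hent : condEntropy2 p * Real.log 2
      = ∑ m, ∑ x, p (m, x) * (Real.log (P m) - Real.log (p (m, x))) := by
    have hlogb : ∀ y, Real.logb 2 y * Real.log 2 = Real.log y := fun y =>
      div_mul_cancel₀ _ hlog2
    simp only [condEntropy2, entropy2, sub_mul, Finset.sum_mul, neg_mul, mul_assoc, hlogb,
      Fintype.sum_prod_type, mul_sub, Finset.sum_sub_distrib, Finset.sum_neg_distrib]
    simp only [hP]
    ring
  have hterm : ∀ m x, p (m, x) * (Real.log (P m) - Real.log (p (m, x)))
      + p (m, x) * Real.log (r m x) ≤ P m * r m x - p (m, x) := by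
    intro m x
    rcases (hp (m, x)).eq_or_lt with h | h
    · rw [← h]
      simpa using mul_nonneg (hP0 m) (hr m x).le
    · have hPpos : 0 < P m :=
        h.trans_le (Finset.single_le_sum (f := fun x => p (m, x)) (fun x _ => hp _)
          (Finset.mem_univ x))
      have hrx := hr m x
      have hle := mul_le_mul_of_nonneg_left
        (Real.log_le_sub_one_of_pos (show 0 < P m * r m x / p (m, x) by positivity)) h.le
      rw [Real.log_div (by positivity) h.ne', Real.log_mul hPpos.ne' hrx.ne', mul_sub_one,
        mul_div_cancel₀ _ h.ne'] at hle
      linarith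
  have hsum : ∑ m, ∑ x, (P m * r m x - p (m, x)) ≤ 0 := by
    refine Finset.sum_nonpos fun m _ => ?_
    rw [Finset.sum_sub_distrib, ← Finset.mul_sum]
    linarith [mul_le_mul_of_nonneg_left (hr1 m) (hP0 m)]
  have hle := (Finset.sum_le_sum fun m (_ : m ∈ Finset.univ) =>
    Finset.sum_le_sum fun x (_ : x ∈ Finset.univ) => hterm m x).trans hsum
  simp only [Finset.sum_add_distrib] at hle
  linarith

/-- **Entropic lower bound on mean square estimation error for lattice-valued variables.**
If the values `ξ x` lie on a lattice of spacing `s`, then every estimator `f : M → ℝ`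
satisfies `∑ p(m,x)(f(m) − ξ(x))² + s²/12 ≥ (s²/(2πe)) 2^{2H(X|M)}`. -/
theorem msd_entropic_lower_bound
    {n : ℕ} {M : Type*} [Fintype M]
    (p : M × Fin n → ℝ)
    (hp0 : ∀ q, 0 ≤ p q) (hp1 : ∑ q, p q = 1)
    (ξ : Fin n → ℝ) (hξinj : Function.Injective ξ)
    (s : ℝ) (hs : 0 < s)
    (hlat : ∀ x x', ∃ k : ℤ, ξ x - ξ x' = k * s)
    (f : M → ℝ) :
    (∑ m, ∑ x, p (m, x) * (f m - ξ x) ^ 2) + s ^ 2 / 12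
      ≥ (s ^ 2 / (2 * Real.pi * Real.exp 1)) * (2 : ℝ) ^ (2 * condEntropy2 p) := by
  have hsep : ∀ x y, x ≠ y → s ≤ |ξ x - ξ y| := by
    intro x y hxy
    obtain ⟨k, hk⟩ := hlat x y
    have hk0 : k ≠ 0 := by
      rintro rfl
      exact hxy (hξinj (by simpa [sub_eq_zero] using hk))
    have hk1 : (1 : ℝ) ≤ |(k : ℝ)| := by exact_mod_cast Int.one_le_abs hk0
    rw [hk, abs_mul, abs_of_pos hs]
    exact le_mul_of_one_le_left hs.le hk1
  set D := ∑ m, ∑ x, p (m, x) * (f m - ξ x) ^ 2 with hD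
  have hD0 : 0 ≤ D :=
    Finset.sum_nonneg fun m _ => Finset.sum_nonneg fun x _ => mul_nonneg (hp0 _) (sq_nonneg _)
  set V := D + s ^ 2 / 12 with hV
  have hV0 : 0 < V := by positivity
  have hπ := Real.pi_pos
  set b := 1 / (2 * V) with hb
  have hb0 : 0 < b := by positivity
  set Z := Real.sqrt (Real.pi / b) with hZ
  have hZ0 : 0 < Z := Real.sqrt_pos.2 (by positivity)
  have hgibbs := condEntropy2_mul_log_two_le p hp0
    (fun m x => s * Real.exp (-b * ((ξ x - f m) ^ 2 + s ^ 2 / 12)) / Z)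
    (fun m x => by positivity) (fun m => by
      rw [← Finset.sum_div, div_le_one hZ0]
      exact sum_mul_exp_le_sqrt_of_separated ξ b (f m) s hb0 hs.le hsep)
  have hlogr : ∀ m x, p (m, x) *
      Real.log (s * Real.exp (-b * ((ξ x - f m) ^ 2 + s ^ 2 / 12)) / Z)
      = p (m, x) * (Real.log s - Real.log Z - b * (s ^ 2 / 12))
        - b * (p (m, x) * (f m - ξ x) ^ 2) := by
    intro m x
    rw [Real.log_div (by positivity) hZ0.ne', Real.log_mul hs.ne' (Real.exp_pos _).ne',
      Real.log_exp]
    ring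
  have hp1' : ∑ m, ∑ x, p (m, x) = 1 := by rw [← Fintype.sum_prod_type]; exact hp1
  simp only [hlogr, Finset.sum_sub_distrib, ← Finset.sum_mul, ← Finset.mul_sum, hp1', ← hD]
    at hgibbs
  have hbV : b * D + b * (s ^ 2 / 12) = 1 / 2 := by
    rw [← mul_add, ← hV, hb]
    field_simp
  have hexp : (2 : ℝ) ^ (2 * condEntropy2 p) ≤ Z ^ 2 / s ^ 2 * Real.exp 1 := by
    rw [Real.rpow_def_of_pos two_pos]
    calc Real.exp (Real.log 2 * (2 * condEntropy2 p))
        ≤ Real.exp (Real.log (Z ^ 2 / s ^ 2) + 1) := by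
          rw [Real.log_div (by positivity) (by positivity), Real.log_pow, Real.log_pow]
          push_cast
          exact Real.exp_le_exp.2 (by linarith)
      _ = Z ^ 2 / s ^ 2 * Real.exp 1 := by
          rw [Real.exp_add, Real.exp_log (by positivity)]
  have hZsq : Z ^ 2 = 2 * Real.pi * V := by
    rw [hZ, Real.sq_sqrt (by positivity), hb]
    field_simp
  calc s ^ 2 / (2 * Real.pi * Real.exp 1) * (2 : ℝ) ^ (2 * condEntropy2 p)
      ≤ s ^ 2 / (2 * Real.pi * Real.exp 1) * (Z ^ 2 / s ^ 2 * Real.exp 1) :=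
        mul_le_mul_of_nonneg_left hexp (by positivity)
    _ = V := by
        rw [hZsq]
        field_simp
end

section
/- Entropy–variance bound for lattice-valued random variables (Eq. (S.5)). Let S be a finite set of real numbers such that every difference of two elements of S is an integer multiple of some s > 0, and let p be a probability distribution on S with mean μ := ∑_{x∈S} p(x)·x and variance Var := ∑_{x∈S} p(x)·(x − μ)². Then H(p) ≤ (1/2) log₂ (2π e (Var/s² + 1/12)), where H(p) is the Shannon entropy (base 2) of p. -/
open scoped BigOperators

/-- Gibbs' inequality against a positive sub-probability weight. -/
theorem sum_neg_mul_log_le_of_sum_le_one {α : Type*} (S : Finset α) (p r : α → ℝ)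
    (hp0 : ∀ x ∈ S, 0 ≤ p x) (hp1 : ∑ x ∈ S, p x = 1)
    (hr0 : ∀ x ∈ S, 0 < r x) (hr1 : ∑ x ∈ S, r x ≤ 1) :
    ∑ x ∈ S, -(p x * Real.log (p x)) ≤ ∑ x ∈ S, -(p x * Real.log (r x)) := by
  have key : ∀ x ∈ S, -(p x * Real.log (p x)) ≤ -(p x * Real.log (r x)) + (r x - p x) := by
    intro x hx
    have hr := hr0 x hx
    rcases (hp0 x hx).eq_or_lt with h | h
    · simp [← h, hr.le]
    · have h1 := Real.log_le_sub_one_of_pos (div_pos hr h)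
      rw [Real.log_div hr.ne' h.ne'] at h1
      have h2 := mul_le_mul_of_nonneg_left h1 h.le
      have h3 : p x * (r x / p x - 1) = r x - p x := by field_simp
      linarith
  have h := Finset.sum_le_sum key
  rw [Finset.sum_add_distrib, Finset.sum_sub_distrib] at h
  linarith

/-- Jensen's inequality for the Gaussian density on a unit cell centred at `y`. -/
theorem exp_le_setIntegral_gaussianPDFReal (v : NNReal) (y : ℝ) :
    (√(2 * Real.pi * v))⁻¹ * Real.exp (-(y ^ 2 + 1 / 12) / (2 * v))
      ≤ ∫ u in Set.Ioc (y - 1 / 2) (y + 1 / 2), ProbabilityTheory.gaussianPDFReal 0 v u := by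
  rw [← intervalIntegral.integral_of_le (by linarith)]
  set a : ℝ := (2 * (v : ℝ))⁻¹
  have hC : 0 ≤ (√(2 * Real.pi * v))⁻¹ := by positivity
  set C := (√(2 * Real.pi * v))⁻¹
  set E := Real.exp (-(y ^ 2 + 1 / 12) / (2 * v))
  have hI : ∫ u in (y - 1 / 2)..(y + 1 / 2), C * E * (1 + a * (y ^ 2 + 1 / 12) - a * u ^ 2)
      = C * E := by
    rw [intervalIntegral.integral_const_mul, intervalIntegral.integral_sub
      (by simp) (Continuous.intervalIntegrable (by fun_prop) _ _),
      intervalIntegral.integral_const_mul, integral_pow, intervalIntegral.integral_const]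
    simp only [smul_eq_mul]
    push_cast
    ring
  rw [← hI]
  refine intervalIntegral.integral_mono_on (by linarith)
    (Continuous.intervalIntegrable (by fun_prop) _ _)
    (ProbabilityTheory.integrable_gaussianPDFReal 0 v).intervalIntegrable fun u _ ↦ ?_
  rw [ProbabilityTheory.gaussianPDFReal, mul_assoc]
  refine mul_le_mul_of_nonneg_left ?_ hC
  have h1 := Real.add_one_le_exp (a * (y ^ 2 + 1 / 12) - a * u ^ 2)
  calc E * (1 + a * (y ^ 2 + 1 / 12) - a * u ^ 2)
      ≤ E * Real.exp (a * (y ^ 2 + 1 / 12) - a * u ^ 2) :=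
        mul_le_mul_of_nonneg_left (by linarith) (Real.exp_pos _).le
    _ = Real.exp (-(u - 0) ^ 2 / (2 * v)) := by
        rw [← Real.exp_add]
        congr 1
        simp only [a, div_eq_mul_inv]
        ring

/-- The Jensen lower bounds for the Gaussian masses of unit cells centred at points whose pairwise
differences are integers sum to at most one. -/
theorem sum_exp_le_one_of_integer_differences {α : Type*} (S : Finset α) (y : α → ℝ)
    (hy : ∀ i ∈ S, ∀ j ∈ S, i ≠ j → ∃ k : ℤ, k ≠ 0 ∧ y i - y j = k)
    (v : NNReal) (hv : v ≠ 0) :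
    ∑ i ∈ S, (√(2 * Real.pi * v))⁻¹ * Real.exp (-(y i ^ 2 + 1 / 12) / (2 * v)) ≤ 1 := by
  have hint := ProbabilityTheory.integrable_gaussianPDFReal 0 v
  refine (Finset.sum_le_sum fun i _ ↦ exp_le_setIntegral_gaussianPDFReal v (y i)).trans ?_
  rw [← MeasureTheory.integral_biUnion_finset S (fun i _ ↦ measurableSet_Ioc) ?_
    (fun i _ ↦ hint.integrableOn), ← ProbabilityTheory.integral_gaussianPDFReal_eq_one 0 hv]
  · exact MeasureTheory.setIntegral_le_integral hint
      (Filter.Eventually.of_forall fun u ↦ ProbabilityTheory.gaussianPDFReal_nonneg 0 v u)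
  · intro i hi j hj hij
    refine Set.disjoint_left.2 fun z hz hz' ↦ ?_
    obtain ⟨k, hk, hkk⟩ := hy i hi j hj hij
    apply hk
    have h1 : (k : ℝ) < 1 := by linarith [hz.1, hz'.2]
    have h2 : (-1 : ℝ) < k := by linarith [hz.2, hz'.1]
    have h3 : k < 1 := by exact_mod_cast h1
    have h4 : -1 < k := by exact_mod_cast h2
    omega

/-- **Entropy–variance bound for lattice-valued random variables (Eq. (S.5)).**
If a probability distribution `p` is supported on a finite set `S ⊆ ℝ` whose elements
differ by integer multiples of `s > 0`, then
`H(p) ≤ (1/2) log₂(2πe(Var/s² + 1/12))`. -/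
theorem entropy_variance_bound
    (S : Finset ℝ) (s : ℝ) (hs : 0 < s)
    (hlat : ∀ x ∈ S, ∀ y ∈ S, ∃ k : ℤ, x - y = k * s)
    (p : ℝ → ℝ)
    (hp0 : ∀ x ∈ S, 0 ≤ p x) (hp1 : ∑ x ∈ S, p x = 1) :
    (∑ x ∈ S, -(p x * Real.logb 2 (p x)))
      ≤ (1 / 2) * Real.logb 2 (2 * Real.pi * Real.exp 1
          * ((∑ x ∈ S, p x * (x - ∑ y ∈ S, p y * y) ^ 2) / s ^ 2 + 1 / 12)) := by
  set m := ∑ y ∈ S, p y * y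
  set V := ∑ x ∈ S, p x * (x - m) ^ 2 with hV
  have hV0 : 0 ≤ V := Finset.sum_nonneg fun x hx ↦ mul_nonneg (hp0 x hx) (sq_nonneg _)
  have hw : 0 < V / s ^ 2 + 1 / 12 := by positivity
  set w := V / s ^ 2 + 1 / 12 with hw_def
  have hlog2 : 0 < Real.log 2 := Real.log_pos one_lt_two
  set r : ℝ → ℝ := fun x ↦
    (√(2 * Real.pi * w))⁻¹ * Real.exp (-(((x - m) / s) ^ 2 + 1 / 12) / (2 * w)) with hr
  have hr1 : ∑ x ∈ S, r x ≤ 1 := by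
    refine sum_exp_le_one_of_integer_differences S (fun x ↦ (x - m) / s) ?_ ⟨w, hw.le⟩
      (fun h ↦ hw.ne' (congrArg NNReal.toReal h))
    intro x hx y hy hxy
    obtain ⟨k, hk⟩ := hlat x hx y hy
    refine ⟨k, ?_, ?_⟩
    · rintro rfl
      exact hxy (by simpa [sub_eq_zero] using hk)
    · rw [← sub_div, sub_sub_sub_cancel_right, hk, mul_div_cancel_right₀ _ hs.ne']
  have hgibbs := sum_neg_mul_log_le_of_sum_le_one S p r hp0 hp1 (fun x _ ↦ by positivity) hr1
  have hlogr : ∀ x, Real.log (r x)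
      = -(Real.log (2 * Real.pi * w) / 2) - (((x - m) / s) ^ 2 + 1 / 12) / (2 * w) := by
    intro x
    rw [hr, Real.log_mul (by positivity) (by positivity), Real.log_inv, Real.log_exp,
      Real.log_sqrt (by positivity)]
    ring
  have hcross : ∑ x ∈ S, -(p x * Real.log (r x)) = (Real.log (2 * Real.pi * w) + 1) / 2 := by
    have hterm : ∀ x ∈ S, -(p x * Real.log (r x))
        = p x * (Real.log (2 * Real.pi * w) / 2 + 1 / 12 / (2 * w))
          + p x * (x - m) ^ 2 * (1 / (s ^ 2 * (2 * w))) := by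
      intro x _
      rw [hlogr]
      field_simp
      ring
    rw [Finset.sum_congr rfl hterm, Finset.sum_add_distrib, ← Finset.sum_mul, ← Finset.sum_mul,
      hp1, ← hV]
    have hVw : V = (w - 1 / 12) * s ^ 2 := by
      rw [hw_def]
      field_simp
      ring
    rw [hVw]
    field_simp
    ring
  have hsplit : Real.log (2 * Real.pi * Real.exp 1 * w) = Real.log (2 * Real.pi * w) + 1 := by
    rw [mul_right_comm, Real.log_mul (by positivity) (by positivity), Real.log_exp]
  calc ∑ x ∈ S, -(p x * Real.logb 2 (p x))
      = (∑ x ∈ S, -(p x * Real.log (p x))) / Real.log 2 := by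
        rw [Finset.sum_div]
        refine Finset.sum_congr rfl fun x _ ↦ ?_
        rw [Real.logb]
        ring
    _ ≤ (Real.log (2 * Real.pi * w) + 1) / 2 / Real.log 2 := by
        rw [← hcross]
        gcongr
    _ = 1 / 2 * Real.logb 2 (2 * Real.pi * Real.exp 1 * w) := by
        rw [Real.logb, hsplit]
        ring
end

section
/- Hellman–Raviv bound (Proposition S.1, first part). Let X and M be finite sets and let p(x,m) be a joint probability distribution on X × M. Then there exists a guessing function f : M → X whose total error probability p_e := ∑_{m∈M} ∑_{x ≠ f(m)} p(x,m) satisfies p_e ≤ (1/2) H(X|M), where H(X|M) is the conditional entropy (base 2) of x given m computed from p. -/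
open scoped BigOperators

open Real in
/-- On `[0, 1/2]` the binary entropy lies above its chord. -/
theorem two_mul_mul_log_two_le_binEntropy {e : ℝ} (h0 : 0 ≤ e) (h1 : e ≤ 1 / 2) :
    2 * e * log 2 ≤ binEntropy e := by
  have h := strictConcave_binEntropy.concaveOn.2 (show (0 : ℝ) ∈ Set.Icc 0 1 by simp)
    (show (2⁻¹ : ℝ) ∈ Set.Icc 0 1 by constructor <;> norm_num) (show 0 ≤ 1 - 2 * e by linarith)
    (show 0 ≤ 2 * e by linarith) (by ring)
  have he : (1 - 2 * e) • (0 : ℝ) + (2 * e) • (2⁻¹ : ℝ) = e := by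
    simp only [smul_eq_mul]; ring
  rw [he] at h
  simpa using h

open Real in
/-- A nonnegative quantity bounded by `c` contributes at least `x * (-log c)` to the entropy. -/
theorem mul_neg_log_le_negMulLog {x c : ℝ} (h0 : 0 ≤ x) (h : x ≤ c) :
    x * -log c ≤ negMulLog x := by
  rcases h0.eq_or_lt with rfl | hx
  · simp
  · have := mul_le_mul_of_nonneg_left (log_le_log hx h) hx.le
    rw [negMulLog]
    linarith

open Real in
/-- The Hellman–Raviv bound for one probability vector, in nats. -/
theorem two_mul_one_sub_mul_log_two_le_sum_negMulLog {X : Type*} [Fintype X] [DecidableEq X]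
    (r : X → ℝ) (h0 : ∀ x, 0 ≤ r x) (h1 : ∑ x, r x = 1) (x₀ : X) (hmax : ∀ x, r x ≤ r x₀) :
    2 * (1 - r x₀) * log 2 ≤ ∑ x, negMulLog (r x) := by
  rcases le_total (1 / 2) (r x₀) with h | h
  · have hs := Finset.add_sum_erase Finset.univ r (Finset.mem_univ x₀)
    rw [h1] at hs
    have he : ∑ x ∈ Finset.univ.erase x₀, r x = 1 - r x₀ := by linarith
    have hle : (1 - r x₀) * -log (1 - r x₀) ≤ ∑ x ∈ Finset.univ.erase x₀, negMulLog (r x) := by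
      rw [← he, Finset.sum_mul]
      exact Finset.sum_le_sum fun x hx =>
        mul_neg_log_le_negMulLog (h0 x) (Finset.single_le_sum (fun y _ => h0 y) hx)
    have h0e : 0 ≤ 1 - r x₀ := he ▸ Finset.sum_nonneg fun y _ => h0 y
    have hb := two_mul_mul_log_two_le_binEntropy h0e (by linarith)
    rw [binEntropy_one_sub, binEntropy_eq_negMulLog_add_negMulLog_one_sub] at hb
    rw [← Finset.add_sum_erase Finset.univ (fun x => negMulLog (r x)) (Finset.mem_univ x₀)]
    have hn : negMulLog (1 - r x₀) = (1 - r x₀) * -log (1 - r x₀) := by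
      rw [negMulLog]; ring
    linarith
  · have hpos : 0 < r x₀ := by
      by_contra hn
      have : ∑ x, r x ≤ 0 := Finset.sum_nonpos fun x _ => (hmax x).trans (not_lt.mp hn)
      linarith
    have hle : -log (r x₀) ≤ ∑ x, negMulLog (r x) := by
      calc -log (r x₀) = ∑ x, r x * -log (r x₀) := by rw [← Finset.sum_mul, h1, one_mul]
        _ ≤ _ := Finset.sum_le_sum fun x _ => mul_neg_log_le_negMulLog (h0 x) (hmax x)
    have hlog := log_le_sub_one_of_pos (show 0 < 2 * r x₀ by linarith)
    rw [log_mul two_ne_zero hpos.ne'] at hlog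
    have hl2 : log 2 ≤ 1 := by linarith [log_le_sub_one_of_pos (show (0 : ℝ) < 2 by norm_num)]
    nlinarith [mul_nonneg (sub_nonneg.2 hl2) (show 0 ≤ 1 - 2 * r x₀ by linarith)]

open Real in
/-- The Hellman–Raviv bound for one nonnegative vector, in homogeneous form. -/
theorem two_mul_sum_sub_le_sum_negMulLog {X : Type*} [Fintype X] [DecidableEq X]
    (q : X → ℝ) (h0 : ∀ x, 0 ≤ q x) (x₀ : X) (hmax : ∀ x, q x ≤ q x₀) :
    2 * (∑ x, q x - q x₀) * log 2 ≤ ∑ x, negMulLog (q x) - negMulLog (∑ x, q x) := by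
  obtain ⟨S, hS⟩ : ∃ S, S = ∑ x, q x := ⟨_, rfl⟩
  have hS0 : 0 ≤ S := hS ▸ Finset.sum_nonneg fun x _ => h0 x
  rw [← hS]
  rcases hS0.eq_or_lt with h | h
  · have hz : ∀ x, q x = 0 := fun x =>
      (Finset.sum_eq_zero_iff_of_nonneg fun y _ => h0 y).1 (hS.symm.trans h.symm) x (Finset.mem_univ x)
    simp [hz, ← h]
  · have hb := two_mul_one_sub_mul_log_two_le_sum_negMulLog (fun x => q x / S)
      (fun x => div_nonneg (h0 x) h.le) (by rw [← Finset.sum_div, ← hS, div_self h.ne']) x₀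
      (fun x => div_le_div_of_nonneg_right (hmax x) h.le)
    have hq : ∀ x, negMulLog (q x) = q x / S * negMulLog S + S * negMulLog (q x / S) := by
      intro x
      rw [← negMulLog_mul, mul_div_cancel₀ _ h.ne']
    have hsum : ∑ x, negMulLog (q x) = negMulLog S + S * ∑ x, negMulLog (q x / S) := by
      rw [Finset.sum_congr rfl fun x _ => hq x, Finset.sum_add_distrib, ← Finset.sum_mul,
        ← Finset.sum_div, ← hS, div_self h.ne', one_mul, Finset.mul_sum]
    have hm := mul_le_mul_of_nonneg_left hb h.le
    have hc : S * (2 * (1 - q x₀ / S) * log 2) = 2 * (S - q x₀) * log 2 := by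
      field_simp
    linarith

open Real in
theorem entropy2_eq_sum_negMulLog_div {α : Type*} [Fintype α] (p : α → ℝ) :
    entropy2 p = (∑ a, negMulLog (p a)) / log 2 := by
  rw [entropy2, Finset.sum_div]
  refine Finset.sum_congr rfl fun a _ => ?_
  rw [negMulLog, logb]
  ring

/-- **Hellman–Raviv bound (Proposition S.1, first part).**
For any joint probability distribution `p` on `X × M`, there exists a guessing function
`f : M → X` whose error probability satisfies `p_e ≤ (1/2) H(X|M)`. -/
theorem hellman_raviv
    {X M : Type*} [Fintype X] [Fintype M] [DecidableEq X]
    (p : X × M → ℝ)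
    (hp0 : ∀ q, 0 ≤ p q) (hp1 : ∑ q, p q = 1) :
    ∃ f : M → X,
      (∑ m, ∑ x, if x ≠ f m then p (x, m) else 0)
        ≤ (1 / 2) * condEntropy2 (fun q : M × X => p (q.2, q.1)) := by
  have : Nonempty X := by
    by_contra hX
    rw [not_nonempty_iff] at hX
    simp at hp1
  choose f hf using fun m => Finite.exists_max fun x => p (x, m)
  refine ⟨f, ?_⟩
  have herr : ∀ m, (∑ x, if x ≠ f m then p (x, m) else 0) = ∑ x, p (x, m) - p (f m, m) := by
    intro m
    rw [← Finset.sum_filter, Finset.filter_ne', eq_sub_iff_add_eq,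
      Finset.sum_erase_add _ _ (Finset.mem_univ _)]
  have hsum := Finset.sum_le_sum fun m (_ : m ∈ Finset.univ) =>
    two_mul_sum_sub_le_sum_negMulLog (fun x => p (x, m)) (fun x => hp0 _) (f m) (hf m)
  rw [← Finset.sum_mul, ← Finset.mul_sum, Finset.sum_sub_distrib,
    Finset.sum_sub_distrib] at hsum
  rw [Finset.sum_congr rfl fun m _ => herr m, Finset.sum_sub_distrib, condEntropy2, entropy2_eq_sum_negMulLog_div,
    entropy2_eq_sum_negMulLog_div, Fintype.sum_prod_type, ← sub_div]
  have hl : 0 < Real.log 2 := Real.log_pos one_lt_two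
  have := (le_div_iff₀ hl).2 hsum
  linarith
end

section
/- Zero noise forces maximal disturbance for qubit Pauli observables. Let {ψ^0, ψ^1} and {φ^0, φ^1} be orthonormal bases of ℂ² that are mutually unbiased, i.e. |⟨ψ^x, φ^z⟩|² = 1/2 for all x, z ∈ Fin 2 (the eigenbases of two Pauli observables), with eigenvalue assignments ξ(0) = ζ(0) = 1 and ξ(1) = ζ(1) = −1. Let a quantum instrument be given by Kraus operators K(m,j) and define p_N(m,x) := (1/2) ∑_{j∈J} ‖K(m,j) ψ^x‖². Suppose there exists an estimator f : M → ℝ with ∑_{m,x} p_N(m,x) (f(m) − ξ(x))² = 0 (the MSD noise on X vanishes). Then for every correction operation with Kraus operators E(m,l), the MSD disturbance on Z takes its maximum possible value: ∑_{ẑ,z} p_D(ẑ,z) (ζ(ẑ) − ζ(z))² = 2, where p_D(ẑ,z) := (1/2) ∑_{m,j,l} |⟨φ^{ẑ}, E(m,l) K(m,j) φ^z⟩|². -/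
open scoped BigOperators Matrix

/-- Pauli eigenvalue assignment on a qubit: `+1` for outcome `0` and `−1` for outcome `1`. -/
noncomputable def pauliVal (x : Fin 2) : ℝ := if x = 0 then 1 else -1

lemma dotc_self_eq_sum_normSq {n : ℕ} (v : Fin n → ℂ) :
    dotc v v = ((∑ i, Complex.normSq (v i) : ℝ) : ℂ) := by
  simp [dotc, Complex.normSq_eq_conj_mul_self]

lemma dotc_eq_dotProduct {n : ℕ} (u v : Fin n → ℂ) : dotc u v = star u ⬝ᵥ v := rfl

lemma dotc_smul_right {n : ℕ} (c : ℂ) (u v : Fin n → ℂ) : dotc u (c • v) = c * dotc u v := by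
  simp [dotc_eq_dotProduct]

/-- A complete family of Kraus operators preserves the total squared norm. -/
lemma sum_normSq_mulVec_of_sum_conjTranspose_mul_eq_one {ι : Type*} [Fintype ι] {n k : ℕ}
    (A : ι → Matrix (Fin k) (Fin n) ℂ) (hA : ∑ a, (A a)ᴴ * A a = 1) (v : Fin n → ℂ) :
    ∑ a, ∑ i, Complex.normSq ((A a).mulVec v i) = ∑ i, Complex.normSq (v i) := by
  have h : ∑ a, dotc ((A a).mulVec v) ((A a).mulVec v) = dotc v v := by
    have h1 : ∀ a, dotc ((A a).mulVec v) ((A a).mulVec v)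
        = star v ⬝ᵥ (((A a)ᴴ * A a).mulVec v) := fun a => by
      rw [dotc_eq_dotProduct, Matrix.star_mulVec, ← Matrix.dotProduct_mulVec,
        Matrix.mulVec_mulVec]
    simp only [h1]
    rw [← dotProduct_sum, ← Matrix.sum_mulVec, hA, Matrix.one_mulVec, dotc_eq_dotProduct]
  simp only [dotc_self_eq_sum_normSq] at h
  exact_mod_cast h

/-- The matrix whose rows are the conjugated vectors of an orthonormal basis is unitary. -/
lemma conjTranspose_mul_self_of_orthonormal {n : ℕ} (φ : Fin n → Fin n → ℂ)
    (hφ : ∀ z z', dotc (φ z) (φ z') = if z = z' then 1 else 0) :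
    (Matrix.of fun z i => star (φ z i))ᴴ * (Matrix.of fun z i => star (φ z i)) = 1 := by
  rw [mul_eq_one_comm]
  ext z z'
  simpa [Matrix.mul_apply, Matrix.one_apply, dotc] using hφ z z'

/-- Parseval's identity. -/
lemma sum_normSq_dotc_of_orthonormal {n : ℕ} (φ : Fin n → Fin n → ℂ)
    (hφ : ∀ z z', dotc (φ z) (φ z') = if z = z' then 1 else 0) (v : Fin n → ℂ) :
    ∑ z, Complex.normSq (dotc (φ z) v) = ∑ i, Complex.normSq (v i) := by
  have h := sum_normSq_mulVec_of_sum_conjTranspose_mul_eq_one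
    (fun _ : Unit => Matrix.of fun z i => star (φ z i))
    (by simpa using conjTranspose_mul_self_of_orthonormal φ hφ) v
  simpa [Matrix.mulVec, dotProduct, dotc] using h

/-- Expansion of a vector in an orthonormal basis. -/
lemma sum_dotc_smul_of_orthonormal {n : ℕ} (φ : Fin n → Fin n → ℂ)
    (hφ : ∀ z z', dotc (φ z) (φ z') = if z = z' then 1 else 0) (v : Fin n → ℂ) :
    ∑ z, dotc (φ z) v • φ z = v := by
  have h := congrArg (fun A => A.mulVec v) (conjTranspose_mul_self_of_orthonormal φ hφ)
  simp only [← Matrix.mulVec_mulVec, Matrix.one_mulVec] at h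
  refine Eq.trans ?_ h
  ext i
  simp [Matrix.mulVec, dotProduct, dotc, mul_comm]

/-- With vanishing noise, each outcome excludes one of the two eigenstates of `X`. -/
lemma exists_mulVec_eq_zero_of_noise_eq_zero {d' : ℕ} {M J : Type*} [Fintype M] [Fintype J]
    (ψ : Fin 2 → Fin 2 → ℂ) (K : M → J → Matrix (Fin d') (Fin 2) ℂ) (f : M → ℝ)
    (hf : ∑ m, ∑ x, ((1 / 2 : ℝ) * ∑ j, ∑ i,
        Complex.normSq ((K m j).mulVec (ψ x) i)) * (f m - pauliVal x) ^ 2 = 0) (m : M) :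
    ∃ x, ∀ j, (K m j).mulVec (ψ x) = 0 := by
  have hp : ∀ m x, 0 ≤ (1 / 2 : ℝ) * ∑ j, ∑ i, Complex.normSq ((K m j).mulVec (ψ x) i) :=
    fun m x => mul_nonneg (by norm_num)
      (Finset.sum_nonneg fun j _ => Finset.sum_nonneg fun i _ => Complex.normSq_nonneg _)
  have hm := (Finset.sum_eq_zero_iff_of_nonneg fun m _ => Finset.sum_nonneg fun x _ =>
    mul_nonneg (hp m x) (sq_nonneg _)).1 hf m (Finset.mem_univ m)
  have hx := fun x => (Finset.sum_eq_zero_iff_of_nonneg fun x _ =>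
    mul_nonneg (hp m x) (sq_nonneg _)).1 hm x (Finset.mem_univ x)
  obtain ⟨x, hne⟩ : ∃ x, f m - pauliVal x ≠ 0 := by
    by_contra! h
    have h0 := h 0
    have h1 := h 1
    norm_num [pauliVal] at h0 h1
    linarith
  refine ⟨x, fun j => ?_⟩
  have h0 := (mul_eq_zero.1 (hx x)).resolve_right (pow_ne_zero 2 hne)
  have h1 := (mul_eq_zero.1 h0).resolve_left (by norm_num)
  have h2 := (Finset.sum_eq_zero_iff_of_nonneg fun j _ => Finset.sum_nonneg fun i _ =>
    Complex.normSq_nonneg _).1 h1 j (Finset.mem_univ j)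
  ext i
  exact Complex.normSq_eq_zero.1 ((Finset.sum_eq_zero_iff_of_nonneg fun i _ =>
    Complex.normSq_nonneg _).1 h2 i (Finset.mem_univ i))

/-- If `A` annihilates a vector of one basis, then the squared overlaps of the images under `A` of
the vectors of a mutually unbiased basis all agree. -/
lemma normSq_dotc_mulVec_eq_of_mulVec_eq_zero {k : ℕ} (ψ φ : Fin 2 → Fin 2 → ℂ)
    (hψ : ∀ x x', dotc (ψ x) (ψ x') = if x = x' then 1 else 0)
    (hmub : ∀ x z, Complex.normSq (dotc (ψ x) (φ z)) = 1 / 2)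
    (A : Matrix (Fin k) (Fin 2) ℂ) (x : Fin 2) (hA : A.mulVec (ψ x) = 0) (u : Fin k → ℂ)
    (z z' : Fin 2) :
    Complex.normSq (dotc u (A.mulVec (φ z))) = Complex.normSq (dotc u (A.mulVec (φ z'))) := by
  have key : ∀ z, Complex.normSq (dotc u (A.mulVec (φ z)))
      = 1 / 2 * Complex.normSq (dotc u (A.mulVec (ψ (1 - x)))) := by
    intro z
    have h : A.mulVec (φ z) = dotc (ψ (1 - x)) (φ z) • A.mulVec (ψ (1 - x)) := by
      conv_lhs => rw [← sum_dotc_smul_of_orthonormal ψ hψ (φ z)]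
      fin_cases x <;> simp_all [Fin.sum_univ_two, Matrix.mulVec_add, Matrix.mulVec_smul]
    rw [h, dotc_smul_right, Complex.normSq_mul, hmub]
  rw [key z, key z']

/-- **Zero noise forces maximal disturbance for qubit Pauli observables.**
If the MSD noise on `X` vanishes for some estimator `f`, then for every correction
operation the MSD disturbance on `Z` equals its maximum value `2`. -/
theorem zero_noise_maximal_disturbance
    {d' : ℕ} {M J L : Type*} [Fintype M] [Fintype J] [Fintype L]
    (ψ φ : Fin 2 → (Fin 2 → ℂ))
    (hψ : ∀ x x', dotc (ψ x) (ψ x') = if x = x' then 1 else 0)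
    (hφ : ∀ z z', dotc (φ z) (φ z') = if z = z' then 1 else 0)
    (hmub : ∀ x z, Complex.normSq (dotc (ψ x) (φ z)) = 1 / 2)
    (K : M → J → Matrix (Fin d') (Fin 2) ℂ)
    (hK : ∑ m, ∑ j, (K m j)ᴴ * K m j = 1)
    (f : M → ℝ)
    (hf : ∑ m, ∑ x, ((1 / 2 : ℝ) * ∑ j, ∑ i,
        Complex.normSq ((K m j).mulVec (ψ x) i)) * (f m - pauliVal x) ^ 2 = 0)
    (E : M → L → Matrix (Fin 2) (Fin d') ℂ)
    (hE : ∀ m, ∑ l, (E m l)ᴴ * E m l = 1) :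
    ∑ zh, ∑ z, ((1 / 2 : ℝ) * ∑ m, ∑ j, ∑ l,
        Complex.normSq (dotc (φ zh) ((E m l).mulVec ((K m j).mulVec (φ z)))))
      * (pauliVal zh - pauliVal z) ^ 2 = 2 := by
  have hswap : ∀ m j l zh z z',
      Complex.normSq (dotc (φ zh) ((E m l).mulVec ((K m j).mulVec (φ z))))
        = Complex.normSq (dotc (φ zh) ((E m l).mulVec ((K m j).mulVec (φ z')))) := by
    intro m j l zh z z'
    obtain ⟨x, hx⟩ := exists_mulVec_eq_zero_of_noise_eq_zero ψ K f hf m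
    simp only [Matrix.mulVec_mulVec]
    exact normSq_dotc_mulVec_eq_of_mulVec_eq_zero ψ φ hψ hmub _ x
      (by rw [← Matrix.mulVec_mulVec, hx j, Matrix.mulVec_zero]) _ z z'
  have htotal : ∑ zh, ∑ m, ∑ j, ∑ l,
      Complex.normSq (dotc (φ zh) ((E m l).mulVec ((K m j).mulVec (φ 0)))) = 1 := by
    rw [Finset.sum_comm]
    have h1 : ∀ m, ∑ zh, ∑ j, ∑ l,
        Complex.normSq (dotc (φ zh) ((E m l).mulVec ((K m j).mulVec (φ 0))))
          = ∑ j, ∑ i, Complex.normSq ((K m j).mulVec (φ 0) i) := by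
      intro m
      rw [Finset.sum_comm]
      refine Finset.sum_congr rfl fun j _ => ?_
      rw [Finset.sum_comm,
        ← sum_normSq_mulVec_of_sum_conjTranspose_mul_eq_one (E m) (hE m)]
      exact Finset.sum_congr rfl fun l _ => sum_normSq_dotc_of_orthonormal φ hφ _
    have h2 := sum_normSq_mulVec_of_sum_conjTranspose_mul_eq_one
      (fun a : M × J => K a.1 a.2) (by rw [Fintype.sum_prod_type]; exact hK) (φ 0)
    rw [Fintype.sum_prod_type] at h2
    have h3 := dotc_self_eq_sum_normSq (φ 0)
    rw [hφ 0 0, if_pos rfl] at h3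
    rw [Finset.sum_congr rfl fun m _ => h1 m, h2]
    exact_mod_cast h3.symm
  have h01 : ∑ m, ∑ j, ∑ l,
      Complex.normSq (dotc (φ 0) ((E m l).mulVec ((K m j).mulVec (φ 1))))
        = ∑ m, ∑ j, ∑ l,
      Complex.normSq (dotc (φ 0) ((E m l).mulVec ((K m j).mulVec (φ 0)))) := by
    simp only [fun m j l => hswap m j l 0 1 0]
  rw [Fin.sum_univ_two] at htotal
  simp only [Fin.sum_univ_two, h01]
  rw [show pauliVal 0 = 1 by simp [pauliVal], show pauliVal 1 = -1 by simp [pauliVal]]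
  linarith
end
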